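/- arXiv:2312.17514 — 3 statements merged into one kernel-verified Lean document; each statement's English description precedes it below -/
import Mathlib

section
/- Let d ≥ 2 and let f : ℝ → ℝ be real-analytic on a neighborhood of 0 with f(0) = 0. Let u_L : B(0,1) → ℝ be bounded, satisfy Δu_L = 0 on B(0,1), and u_L(0) = 0. Then there exist r₀ ∈ (0,1], a real-analytic function u : B(0,r₀) → ℝ satisfying Δu(x) = f(u(x)) for all x ∈ B(0,r₀), and a real-analytic function g on B(0,r₀), such that u(x) = u_L(x) + ‖x‖² g(x) for all x ∈ B(0,r₀). -/
open MeasureTheory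

/-- The Laplacian `Δu(x) = Σᵢ ∂²u/∂xᵢ²(x)` of a function on `ℝ^d`, computed via iterated
Fréchet derivatives in the coordinate directions. -/
noncomputable def lap (d : ℕ) (u : EuclideanSpace ℝ (Fin d) → ℝ)
    (x : EuclideanSpace ℝ (Fin d)) : ℝ :=
  ∑ i : Fin d,
    fderiv ℝ (fun y => fderiv ℝ u y (EuclideanSpace.single i 1)) x (EuclideanSpace.single i 1)

set_option linter.unusedSectionVars false
open Filter Topology

/-- Laplacian, vector-valued, arbitrary index type. -/
noncomputable def lapE {ι : Type} [Fintype ι] [DecidableEq ι] {V : Type*} [NormedAddCommGroup V]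
    [NormedSpace ℝ V] (u : EuclideanSpace ℝ ι → V) (x : EuclideanSpace ℝ ι) : V :=
  ∑ i : ι,
    fderiv ℝ (fun y => fderiv ℝ u y (EuclideanSpace.single i 1)) x (EuclideanSpace.single i 1)

theorem lap_eq_lapE (d : ℕ) (u : EuclideanSpace ℝ (Fin d) → ℝ) : lap d u = lapE u := rfl

section Green
variable {ι : Type} [Fintype ι] [DecidableEq ι]

theorem gam_fderiv (x y : EuclideanSpace ℝ ι) (m : ℕ) (ε : ℝ) (hε : 0 < ε) (i : ι) :
    HasFDerivAt (fun y : EuclideanSpace ℝ ι => ((‖y - x‖ ^ 2 + ε) ^ m)⁻¹)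
      (-(2 * m * ((‖y - x‖ ^ 2 + ε) ^ (m+1))⁻¹) • innerSL ℝ (y - x)) y := by
  have hq : 0 < ‖y - x‖ ^ 2 + ε := by positivity
  have h1 : HasFDerivAt (fun y : EuclideanSpace ℝ ι => ‖y - x‖ ^ 2 + ε)
      ((2:ℝ) • innerSL ℝ (y - x)) y := by
    have := (hasStrictFDerivAt_norm_sq (y - x)).hasFDerivAt.comp y
      ((hasFDerivAt_id y).sub_const x)
    refine (this.add_const ε).congr_fderiv ?_
    ext v; simp
  have h2 := (hasDerivAt_inv (𝕜 := ℝ) (x := (‖y - x‖ ^ 2 + ε) ^ m) (by positivity)).comp_hasFDerivAt y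
    ((hasDerivAt_pow m (‖y - x‖ ^ 2 + ε)).comp_hasFDerivAt y h1)
  refine h2.congr_fderiv ?_
  ext v
  rcases m with _ | m
  · simp
  · simp
    field_simp
    ring

theorem gam_fderiv_single (x y : EuclideanSpace ℝ ι) (m : ℕ) (ε : ℝ) (hε : 0 < ε) (i : ι) :
    fderiv ℝ (fun y : EuclideanSpace ℝ ι => ((‖y - x‖ ^ 2 + ε) ^ m)⁻¹) y
      (EuclideanSpace.single i 1) = -(2 * m) * ((y i - x i) * ((‖y - x‖ ^ 2 + ε) ^ (m+1))⁻¹) := by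
  rw [(gam_fderiv x y m ε hε i).fderiv]
  simp [EuclideanSpace.inner_single_right]
  ring

theorem gam_lap (x y : EuclideanSpace ℝ ι) (m : ℕ) (hm : Fintype.card ι = 2 * m + 2)
    (ε : ℝ) (hε : 0 < ε) :
    lapE (fun y : EuclideanSpace ℝ ι => ((‖y - x‖ ^ 2 + ε) ^ m)⁻¹) y
      = - (4 * m * (m + 1)) * (ε * ((‖y - x‖ ^ 2 + ε) ^ (m+2))⁻¹) := by
  have hq : 0 < ‖y - x‖ ^ 2 + ε := by positivity
  unfold lapE
  have key : ∀ i : ι, fderiv ℝ (fun y => fderiv ℝ (fun y : EuclideanSpace ℝ ι =>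
      ((‖y - x‖ ^ 2 + ε) ^ m)⁻¹) y (EuclideanSpace.single i 1)) y (EuclideanSpace.single i 1)
      = -(2*m) * (((‖y - x‖ ^ 2 + ε) ^ (m+1))⁻¹) +
       (4 * m * (m+1)) * (((‖y - x‖ ^ 2 + ε) ^ (m+2))⁻¹) * (y i - x i)^2 := by
    intro i
    simp_rw [fun y => gam_fderiv_single x y m ε hε i]
    have h1 : HasFDerivAt (fun y : EuclideanSpace ℝ ι => y i - x i)
        (EuclideanSpace.proj i : EuclideanSpace ℝ ι →L[ℝ] ℝ) y :=
      (EuclideanSpace.proj (𝕜 := ℝ) i).hasFDerivAt.sub_const _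
    have h2 := ((h1.fun_mul (gam_fderiv x y (m+1) ε hε i)).const_mul (-(2*m : ℝ)))
    rw [h2.fderiv]
    simp [EuclideanSpace.inner_single_right]
    ring
  simp_rw [key]
  rw [Finset.sum_add_distrib, ← Finset.mul_sum, ← Finset.mul_sum]
  have : ∑ i, (y i - x i)^2 = ‖y - x‖^2 := by
    rw [EuclideanSpace.norm_sq_eq]; simp
  rw [this]
  simp [hm]
  field_simp
  ring

theorem gam_contDiff (x : EuclideanSpace ℝ ι) (m : ℕ) (ε : ℝ) (hε : 0 < ε) :
    ContDiff ℝ 2 (fun y : EuclideanSpace ℝ ι => ((‖y - x‖ ^ 2 + ε) ^ m)⁻¹) := by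
  apply ContDiff.inv
  · have : ContDiff ℝ 2 (fun y : EuclideanSpace ℝ ι => ‖y - x‖ ^ 2) :=
      (contDiff_id.sub contDiff_const).norm_sq ℝ
    exact (this.add contDiff_const).pow m
  · intro y; positivity

theorem cd_fderiv_apply {V : Type*} [NormedAddCommGroup V] [NormedSpace ℝ V]
    {u : EuclideanSpace ℝ ι → V} {n k : WithTop ℕ∞} (hu : ContDiff ℝ n u) (h : k + 1 ≤ n)
    (e : EuclideanSpace ℝ ι) :
    ContDiff ℝ k (fun y => fderiv ℝ u y e) :=
  (hu.fderiv_right h).clm_apply contDiff_const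

theorem ibp1 (G v : EuclideanSpace ℝ ι → ℝ) (hG : ContDiff ℝ 1 G) (hv : ContDiff ℝ 1 v)
    (hc : HasCompactSupport v) (e : EuclideanSpace ℝ ι) :
    ∫ y, G y * fderiv ℝ v y e = - ∫ y, fderiv ℝ G y e * v y := by
  have hG' := (cd_fderiv_apply hG (k := 0) (by simp) e).continuous
  have hv' := (cd_fderiv_apply hv (k := 0) (by simp) e).continuous
  apply integral_mul_fderiv_eq_neg_fderiv_mul_of_integrable
  · exact (hG'.mul hv.continuous).integrable_of_hasCompactSupport hc.mul_left
  · exact (hG.continuous.mul hv').integrable_of_hasCompactSupport (hc.fderiv_apply ℝ e).mul_left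
  · exact (hG.continuous.mul hv.continuous).integrable_of_hasCompactSupport hc.mul_left
  · intro y _; exact hG.differentiable (by simp) y
  · intro y _; exact hv.differentiable (by simp) y

theorem green (G v : EuclideanSpace ℝ ι → ℝ) (hG : ContDiff ℝ 2 G) (hv : ContDiff ℝ 2 v)
    (hc : HasCompactSupport v) :
    ∫ y, G y * lapE v y = ∫ y, lapE G y * v y := by
  unfold lapE
  simp_rw [Finset.mul_sum, Finset.sum_mul]
  have h21 : (1 : WithTop ℕ∞) + 1 ≤ 2 := by norm_num
  have h01 : (0 : WithTop ℕ∞) + 1 ≤ 1 := by norm_num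
  rw [integral_finsetSum, integral_finsetSum]
  · refine Finset.sum_congr rfl fun i _ => ?_
    set e : EuclideanSpace ℝ ι := EuclideanSpace.single i 1
    have hG1 := cd_fderiv_apply hG h21 e
    have hv1 := cd_fderiv_apply hv h21 e
    rw [ibp1 G _ (hG.of_le (by norm_num)) hv1 (hc.fderiv_apply ℝ e) e, ibp1 _ v hG1 (hv.of_le (by norm_num)) hc e,
      neg_neg]
  · intro i _
    exact ((cd_fderiv_apply (cd_fderiv_apply hG h21 _) h01 _).continuous.mul hv.continuous).integrable_of_hasCompactSupport hc.mul_left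
  · intro i _
    exact (hG.continuous.mul (cd_fderiv_apply (cd_fderiv_apply hv h21 _) h01 _).continuous).integrable_of_hasCompactSupport
     ((hc.fderiv_apply ℝ _).fderiv_apply ℝ _).mul_left

theorem lapE_continuous {v : EuclideanSpace ℝ ι → ℝ} (hv : ContDiff ℝ 2 v) :
    Continuous (lapE v) := by
  have h21 : (1 : WithTop ℕ∞) + 1 ≤ 2 := by norm_num
  have h01 : (0 : WithTop ℕ∞) + 1 ≤ 1 := by norm_num
  unfold lapE
  exact continuous_finsetSum _ fun i _ => 
    (cd_fderiv_apply (cd_fderiv_apply hv h21 _) h01 _).continuous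

end Green
section Rep
variable {ι : Type} [Fintype ι] [DecidableEq ι]

set_option maxHeartbeats 1000000 in
theorem rep (m : ℕ) (hm0 : 1 ≤ m) (hm : Fintype.card ι = 2 * m + 2) :
    ∃ C : ℝ, ∀ v : EuclideanSpace ℝ ι → ℝ, ContDiff ℝ 2 v → HasCompactSupport v →
      ∀ x, ∀ δ > 0, (∀ y, ‖y - x‖ < δ → lapE v y = 0) →
        v x = C * ∫ y, ((‖y - x‖ ^ 2) ^ m)⁻¹ * lapE v y := by
  let ψ : EuclideanSpace ℝ ι → ℝ := fun w => ((1 + ‖w‖ ^ 2) ^ (m+2))⁻¹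
  have hψ0 : ∀ w, 0 < ψ w := fun w => by positivity
  have hψi : Integrable ψ := by
    have := integrable_rpow_neg_one_add_norm_sq (μ := (volume : Measure (EuclideanSpace ℝ ι)))
      (r := 2 * (m + 2)) (by simp [hm]; linarith)
    refine this.congr (Eventually.of_forall fun w => ?_)
    have h1 : (0:ℝ) < 1 + ‖w‖^2 := by positivity
    simp only [ψ]
    generalize 1 + ‖w‖ ^ 2 = q at h1
    rw [← Real.rpow_natCast, ← Real.rpow_neg h1.le]
    congr 1
    push_cast; ring
  have hI : 0 < ∫ w, ψ w := by
    rw [integral_pos_iff_support_of_nonneg (fun w => (hψ0 w).le) hψi]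
    have : Function.support ψ = Set.univ := by
      ext w; simp [(hψ0 w).ne']
    rw [this]
    exact Measure.measure_univ_pos.2 (NeZero.ne _)
  obtain ⟨I, hIdef⟩ : ∃ I, I = ∫ w, ψ w := ⟨_, rfl⟩
  rw [← hIdef] at hI
  let φ : EuclideanSpace ℝ ι → ℝ := fun w => I⁻¹ * ψ w
  have hφ1 : ∫ w, φ w = 1 := by
    simp only [φ]; rw [integral_const_mul, ← hIdef]; exact inv_mul_cancel₀ hI.ne'
  have hφlim : Tendsto (fun w => ‖w‖ ^ Module.finrank ℝ (EuclideanSpace ℝ ι) * φ w)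
      (Bornology.cobounded _) (𝓝 0) := by
    have h1 : Tendsto (fun w : EuclideanSpace ℝ ι => I⁻¹ * (‖w‖ ^ 2)⁻¹) (Bornology.cobounded _) (𝓝 0) := by
      have : Tendsto (fun w : EuclideanSpace ℝ ι => (‖w‖ ^ 2)⁻¹) (Bornology.cobounded _) (𝓝 0) :=
        tendsto_inv_atTop_zero.comp ((tendsto_pow_atTop (by norm_num)).comp tendsto_norm_cobounded_atTop)
      simpa using this.const_mul I⁻¹
    refine squeeze_zero' (Eventually.of_forall fun w => ?_) ?_ h1
    · have := hψ0 w; positivity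
    · filter_upwards [tendsto_norm_cobounded_atTop.eventually (eventually_gt_atTop 0)] with w hw
      simp only [φ, ψ, finrank_euclideanSpace, hm]
      have : ((1 + ‖w‖ ^ 2) ^ (m+2))⁻¹ ≤ ((‖w‖ ^ 2) ^ (m+2))⁻¹ := by
        apply inv_anti₀ (by positivity)
        exact pow_le_pow_left₀ (by positivity) (by linarith) _
      calc ‖w‖ ^ (2 * m + 2) * (I⁻¹ * ((1 + ‖w‖ ^ 2) ^ (m+2))⁻¹)
          ≤ ‖w‖ ^ (2 * m + 2) * (I⁻¹ * ((‖w‖ ^ 2) ^ (m+2))⁻¹) :=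
            mul_le_mul_of_nonneg_left (mul_le_mul_of_nonneg_left this (by positivity)) (by positivity)
        _ = I⁻¹ * (‖w‖ ^ 2)⁻¹ := by
          field_simp
          ring
  refine ⟨I⁻¹ * (-(4 * m * (m+1) : ℝ))⁻¹, fun v hv hc x δ hδ hx => ?_⟩
  have hlc := lapE_continuous hv
  have hlcs : HasCompactSupport (lapE v) := by
    unfold lapE
    refine HasCompactSupport.intro hc ?_
    intro y hy
    refine Finset.sum_eq_zero fun i _ => ?_
    by_contra hne
    exact hy (tsupport_fderiv_apply_subset ℝ _ (tsupport_fderiv_apply_subset ℝ _ (subset_tsupport _ hne)))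
  have hli : Integrable (lapE v) := hlc.integrable_of_hasCompactSupport hlcs
  have T1 := tendsto_integral_comp_smul_smul_of_integrable' (μ := volume) (φ := φ)
    (fun w => by have := hψ0 w; positivity) hφ1 hφlim
    (hv.continuous.integrable_of_hasCompactSupport hc) (x₀ := x) hv.continuous.continuousAt
  have T2 : Tendsto (fun c : ℝ => ∫ y, ((‖y - x‖ ^ 2 + (c^2)⁻¹) ^ m)⁻¹ * lapE v y) atTop
      (𝓝 (∫ y, ((‖y - x‖ ^ 2) ^ m)⁻¹ * lapE v y)) := by
    apply tendsto_integral_filter_of_dominated_convergence (fun y => ((δ ^ 2) ^ m)⁻¹ * ‖lapE v y‖)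
    · filter_upwards [eventually_gt_atTop 0] with c hc
      exact ((gam_contDiff x m _ (by positivity)).continuous.mul hlc).aestronglyMeasurable
    · filter_upwards [eventually_gt_atTop 0] with c hc
      refine Eventually.of_forall fun y => ?_
      by_cases hy : ‖y - x‖ < δ
      · simp [hx y hy]
      · rw [norm_mul, norm_inv, norm_pow, Real.norm_of_nonneg (by positivity)]
        push Not at hy
        have : 0 < (c^2)⁻¹ := by positivity
        gcongr
        nlinarith
    · exact hli.norm.const_mul _
    · refine Eventually.of_forall fun y => ?_
      by_cases hy : ‖y - x‖ < δ
      · simp [hx y hy]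
      · push Not at hy
        have hpos : 0 < ‖y - x‖ := lt_of_lt_of_le hδ hy
        have h0 : Tendsto (fun c : ℝ => (c^2)⁻¹) atTop (𝓝 0) :=
          tendsto_inv_atTop_zero.comp (tendsto_pow_atTop (by norm_num))
        have := ((h0.const_add (‖y - x‖^2)).pow m).inv₀ (by simp; intro h; simp [h] at hpos)
        simpa using this.mul_const (lapE v y)
  have T3 : Tendsto (fun c : ℝ => ∫ y, (c ^ (Module.finrank ℝ (EuclideanSpace ℝ ι)) * φ (c • (x - y))) • v y)
      atTop (𝓝 (I⁻¹ * (-(4 * m * (m+1) : ℝ))⁻¹ * ∫ y, ((‖y - x‖ ^ 2) ^ m)⁻¹ * lapE v y)) := by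
    refine (T2.const_mul _).congr' ?_
    filter_upwards [eventually_gt_atTop 0] with c hc'
    rw [green _ v (gam_contDiff x m _ (by positivity)) hv hc, ← integral_const_mul]
    refine integral_congr_ae (Eventually.of_forall fun y => ?_)
    simp only
    rw [gam_lap x y m hm _ (by positivity)]
    simp only [φ, ψ, finrank_euclideanSpace, hm, norm_smul, Real.norm_of_nonneg hc'.le, smul_eq_mul,
      norm_sub_rev x y]
    have e1 : 1 + (c * ‖y - x‖)^2 = c^2 * (‖y - x‖ ^ 2 + (c^2)⁻¹) := by field_simp; ring
    rw [e1, mul_pow]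
    have : 0 < ‖y - x‖ ^ 2 + (c^2)⁻¹ := by positivity
    set q := ‖y - x‖ ^ 2 + (c^2)⁻¹
    have hm' : (0:ℝ) < m := by exact_mod_cast hm0
    field_simp
    ring
  exact tendsto_nhds_unique T1 T3

end Rep
section Harm
variable {ι : Type} [Fintype ι] [DecidableEq ι]

theorem lapE_congr {V : Type*} [NormedAddCommGroup V] [NormedSpace ℝ V]
    {u v : EuclideanSpace ℝ ι → V} {x : EuclideanSpace ℝ ι} (h : u =ᶠ[𝓝 x] v) :
    lapE u x = lapE v x := by
  unfold lapE
  refine Finset.sum_congr rfl fun i _ => ?_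
  have : (fun y => fderiv ℝ u y (EuclideanSpace.single i 1)) =ᶠ[𝓝 x]
      (fun y => fderiv ℝ v y (EuclideanSpace.single i 1)) := by
    filter_upwards [h.eventuallyEq_nhds] with y hy
    rw [hy.fderiv_eq]
  rw [this.fderiv_eq]

theorem harm_even (m : ℕ) (hm0 : 1 ≤ m) (hm : Fintype.card ι = 2 * m + 2)
    (u : EuclideanSpace ℝ ι → ℝ) (hu : ContDiffOn ℝ 2 u (Metric.ball 0 1))
    (hl : ∀ x ∈ Metric.ball (0 : EuclideanSpace ℝ ι) 1, lapE u x = 0) :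
    AnalyticAt ℝ u 0 := by
  obtain ⟨C, hC⟩ := rep (ι := ι) m hm0 hm
  let χ : ContDiffBump (0 : EuclideanSpace ℝ ι) := ⟨1/2, 3/4, by norm_num, by norm_num⟩
  let v : EuclideanSpace ℝ ι → ℝ := fun y => χ y * u y
  have hts : tsupport χ = Metric.closedBall 0 (3/4) := χ.tsupport_eq
  have hv0 : ∀ x, x ∉ Metric.closedBall (0 : EuclideanSpace ℝ ι) (3/4) → v =ᶠ[𝓝 x] fun _ => 0 := by
    intro x hx
    rw [← hts] at hx
    filter_upwards [notMem_tsupport_iff_eventuallyEq.1 hx] with y hy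
    simp [v, hy]
  have hv : ContDiff ℝ 2 v := by
    rw [contDiff_iff_contDiffAt]
    intro x
    by_cases hx : x ∈ Metric.closedBall (0 : EuclideanSpace ℝ ι) (3/4)
    · apply χ.contDiffAt.mul
      apply hu.contDiffAt
      apply Metric.isOpen_ball.mem_nhds
      exact Metric.closedBall_subset_ball (by norm_num) hx
    · exact contDiffAt_const.congr_of_eventuallyEq (hv0 x hx)
  have hvc : HasCompactSupport v := χ.hasCompactSupport.mul_right
  have hvu : ∀ x ∈ Metric.ball (0 : EuclideanSpace ℝ ι) (1/2), v =ᶠ[𝓝 x] u := by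
    intro x hx
    filter_upwards [Metric.isOpen_ball.mem_nhds hx] with y hy
    have : χ y = 1 := χ.one_of_mem_closedBall (Metric.ball_subset_closedBall hy)
    simp [v, this]
  have hh0 : ∀ x ∈ Metric.ball (0 : EuclideanSpace ℝ ι) (1/2), lapE v x = 0 := by
    intro x hx
    rw [lapE_congr (hvu x hx)]
    exact hl x (Metric.ball_subset_ball (by norm_num) hx)
  have hh1 : ∀ x, x ∉ Metric.closedBall (0 : EuclideanSpace ℝ ι) (3/4) → lapE v x = 0 := by
    intro x hx
    rw [lapE_congr (hv0 x hx)]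
    simp [lapE]
  have hcont : Continuous (lapE v) := lapE_continuous hv
  let K : Set (EuclideanSpace ℝ ι) := Metric.closedBall 0 (3/4) \ Metric.ball 0 (1/2)
  have hK : IsCompact K := (isCompact_closedBall _ _).diff Metric.isOpen_ball
  have hKm : MeasurableSet K := hK.measurableSet
  have : CompactSpace K := isCompact_iff_compactSpace.1 hK
  let μ : Measure K := volume.comap Subtype.val
  have : IsFiniteMeasure μ := by
    constructor
    simp only [μ]
    rw [Measure.comap_apply _ Subtype.val_injective (fun s hs => hKm.subtype_image hs) _ MeasurableSet.univ]
    simpa using hK.measure_lt_top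
  have hint : ∀ φ : C(K, ℝ), Integrable (fun y : K => φ y * lapE v y) μ := by
    intro φ
    have : Continuous (fun y : K => φ y * lapE v y) := φ.continuous.mul (hcont.comp continuous_subtype_val)
    exact this.integrable_of_hasCompactSupport (HasCompactSupport.of_compactSpace _)
  let L : C(K, ℝ) →L[ℝ] ℝ := LinearMap.mkContinuous
    { toFun := fun φ => ∫ y : K, φ y * lapE v y ∂μ
      map_add' := by
        intro a b
        rw [← integral_add (hint a) (hint b)]
        simp [add_mul]
      map_smul' := by
        intro c a
        simp only [ContinuousMap.coe_smul, Pi.smul_apply, smul_eq_mul, mul_assoc, RingHom.id_apply]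
        rw [integral_const_mul] } (∫ y : K, ‖lapE v y‖ ∂μ) (by
        intro φ
        simp only [LinearMap.coe_mk, AddHom.coe_mk]
        refine (norm_integral_le_integral_norm _).trans ?_
        rw [← integral_mul_const]
        refine integral_mono (hint φ).norm ?_ ?_
        · have := (hint 1).norm.mul_const ‖φ‖
          simpa using this
        · intro y
          simp only [norm_mul]
          rw [mul_comm]
          exact mul_le_mul_of_nonneg_left (φ.norm_coe_le_norm y) (norm_nonneg _))
  let cc : ι → C(K, ℝ) := fun i => ⟨fun y => (y : EuclideanSpace ℝ ι) i, by fun_prop⟩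
  let q : EuclideanSpace ℝ ι → C(K, ℝ) := fun x => ∑ i, (x i • (1 : C(K, ℝ)) - cc i) ^ 2
  have hqa : AnalyticAt ℝ q 0 := by
    apply Finset.analyticAt_fun_sum
    intro i _
    apply AnalyticAt.fun_pow
    apply AnalyticAt.fun_sub _ analyticAt_const
    exact (((EuclideanSpace.proj (𝕜 := ℝ) i : EuclideanSpace ℝ ι →L[ℝ] ℝ).smulRight (1 : C(K,ℝ))).analyticAt 0)
  have hqv : ∀ x (y : K), q x y = ‖(y : EuclideanSpace ℝ ι) - x‖ ^ 2 := by
    intro x y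
    rw [EuclideanSpace.norm_sq_eq]
    simp [q, cc]
    refine Finset.sum_congr rfl fun i _ => ?_
    ring
  have hKf : ∀ x : EuclideanSpace ℝ ι, ‖x‖ < 1/4 → ∀ y ∈ K, 0 < ‖y - x‖ := by
    intro x hx y hy
    have : 1/2 ≤ ‖y‖ := by simpa using hy.2
    have := norm_sub_norm_le y x
    linarith
  have hqu : ∀ x : EuclideanSpace ℝ ι, ‖x‖ < 1/4 → IsUnit (q x) := by
    intro x hx
    rw [ContinuousMap.isUnit_iff_forall_ne_zero]
    intro y
    rw [hqv]
    have := hKf x hx y y.2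
    positivity
  have hLa : AnalyticAt ℝ (fun x => C * L (Ring.inverse (q x) ^ m)) 0 := by
    apply AnalyticAt.fun_mul analyticAt_const
    apply AnalyticAt.fun_comp (L.analyticAt _)
    apply AnalyticAt.fun_pow
    obtain ⟨z, hz⟩ := hqu 0 (by simp)
    have := analyticAt_inverse (𝕜 := ℝ) z
    rw [hz] at this
    exact AnalyticAt.fun_comp this hqa
  refine hLa.congr ?_
  filter_upwards [Metric.ball_mem_nhds (0 : EuclideanSpace ℝ ι) (show (0:ℝ) < 1/4 by norm_num)] with x hx
  have hx' : ‖x‖ < 1/4 := by simpa using hx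
  have hux : u x = v x := (hvu x (Metric.ball_subset_ball (by norm_num) hx)).eq_of_nhds.symm
  rw [hux, hC v hv hvc x (1/4) (by norm_num)]
  · congr 1
    have : ∀ y : K, (Ring.inverse (q x) ^ m) y = ((‖(y : EuclideanSpace ℝ ι) - x‖ ^ 2) ^ m)⁻¹ := by
      intro y
      have h1 := congrArg (fun φ : C(K, ℝ) => φ y) (Ring.mul_inverse_cancel _ (hqu x hx'))
      simp only [ContinuousMap.mul_apply, ContinuousMap.one_apply, hqv] at h1
      rw [ContinuousMap.pow_apply, ← inv_pow]
      congr 1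
      exact eq_inv_of_mul_eq_one_right h1
    change ∫ y : K, (Ring.inverse (q x) ^ m) y * lapE v y ∂μ = _
    simp_rw [this]
    rw [integral_subtype_comap hKm (fun y => ((‖y - x‖ ^ 2) ^ m)⁻¹ * lapE v y)]
    apply setIntegral_eq_integral_of_forall_compl_eq_zero
    intro y hy
    have : lapE v y = 0 := by
      by_cases h : y ∈ Metric.closedBall (0 : EuclideanSpace ℝ ι) (3/4)
      · apply hh0
        by_contra h'
        exact hy ⟨h, h'⟩
      · exact hh1 y h
    simp [this]
  · intro y hy
    apply hh0
    rw [mem_ball_zero_iff]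
    have := norm_sub_norm_le y x
    linarith

end Harm

theorem harm_analytic (d : ℕ) (hd : 2 ≤ d) (u : EuclideanSpace ℝ (Fin d) → ℝ)
    (hu : ContDiffOn ℝ 2 u (Metric.ball 0 1))
    (hl : ∀ x ∈ Metric.ball (0 : EuclideanSpace ℝ (Fin d)) 1, lapE u x = 0) :
    AnalyticAt ℝ u 0 := by
  let P : EuclideanSpace ℝ (Fin d ⊕ Fin d) →L[ℝ] EuclideanSpace ℝ (Fin d) :=
    LinearMap.toContinuousLinearMap
      { toFun := fun y => WithLp.toLp 2 (fun i => y (Sum.inl i))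
        map_add' := by intro a b; ext i; simp
        map_smul' := by intro a b; ext i; simp }
  let J : EuclideanSpace ℝ (Fin d) →L[ℝ] EuclideanSpace ℝ (Fin d ⊕ Fin d) :=
    LinearMap.toContinuousLinearMap
      { toFun := fun y => WithLp.toLp 2 (Sum.elim (fun i => y i) (fun _ => 0))
        map_add' := by intro a b; ext i; rcases i <;> simp
        map_smul' := by intro a b; ext i; rcases i <;> simp }
  have hPJ : ∀ x, P (J x) = x := by intro x; ext i; simp [P, J]
  have hPn : ∀ y, ‖P y‖ ≤ ‖y‖ := by
    intro y
    rw [EuclideanSpace.norm_eq, EuclideanSpace.norm_eq]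
    apply Real.sqrt_le_sqrt
    rw [Fintype.sum_sum_type]
    simp only [P, LinearMap.coe_toContinuousLinearMap', LinearMap.coe_mk, AddHom.coe_mk]
    have : 0 ≤ ∑ i : Fin d, ‖y (Sum.inr i)‖^2 := by positivity
    linarith
  have hPb : ∀ y ∈ Metric.ball (0 : EuclideanSpace ℝ (Fin d ⊕ Fin d)) 1, P y ∈ Metric.ball 0 1 := by
    intro y hy
    rw [mem_ball_zero_iff] at *
    exact (hPn y).trans_lt hy
  have hPl : ∀ i, P (EuclideanSpace.single (Sum.inl i) 1) = EuclideanSpace.single i 1 := by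
    intro i; ext j; simp [P]
  have hPr : ∀ i, P (EuclideanSpace.single (Sum.inr i) 1) = 0 := by
    intro i; ext j; simp [P]
  have hbo : IsOpen (Metric.ball (0 : EuclideanSpace ℝ (Fin d)) 1) := Metric.isOpen_ball
  have hA : AnalyticAt ℝ (fun y => u (P y)) 0 := by
    apply harm_even (d - 1) (by omega) (by simp; omega)
    · exact hu.comp P.contDiff.contDiffOn hPb
    · intro y hy
      have h1 : ∀ e : EuclideanSpace ℝ (Fin d ⊕ Fin d),
          (fun z => fderiv ℝ (fun y => u (P y)) z e) =ᶠ[𝓝 y] fun z => (fun w => fderiv ℝ u w (P e)) (P z) := by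
        intro e
        filter_upwards [Metric.isOpen_ball.mem_nhds hy] with z hz
        have hd := ((hu.contDiffAt (hbo.mem_nhds (hPb z hz))).differentiableAt (by norm_num)).hasFDerivAt.comp z P.hasFDerivAt
        change fderiv ℝ (u ∘ P) z e = _
        rw [hd.fderiv]; rfl
      have h2 : ∀ e : EuclideanSpace ℝ (Fin d ⊕ Fin d),
          fderiv ℝ (fun z => fderiv ℝ (fun y => u (P y)) z e) y e =
            fderiv ℝ (fun w => fderiv ℝ u w (P e)) (P y) (P e) := by
        intro e
        rw [(h1 e).fderiv_eq]
        have hc : ContDiffAt ℝ 1 (fun w => fderiv ℝ u w (P e)) (P y) :=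
          ((hu.contDiffAt (hbo.mem_nhds (hPb y hy))).fderiv_right (by norm_num)).clm_apply contDiffAt_const
        have hd := (hc.differentiableAt (by norm_num)).hasFDerivAt.comp y P.hasFDerivAt
        change fderiv ℝ ((fun w => fderiv ℝ u w (P e)) ∘ P) y e = _
        rw [hd.fderiv]; rfl
      unfold lapE
      simp_rw [h2]
      rw [Fintype.sum_sum_type]
      simp_rw [hPl, hPr]
      simp
      exact hl _ (hPb y hy)
  have hB : AnalyticAt ℝ (fun x => u (P (J x))) 0 := by
    have h0 : J 0 = 0 := map_zero J
    rw [← h0] at hA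
    exact AnalyticAt.fun_comp (g := fun y => u (P y)) (f := J) hA (J.analyticAt 0)
  simpa only [hPJ] using hB
section Mono
variable {d : ℕ}

/-- directional derivative -/
noncomputable def pd (i : Fin d) (u : EuclideanSpace ℝ (Fin d) → ℝ) (y : EuclideanSpace ℝ (Fin d)) : ℝ :=
  fderiv ℝ u y (EuclideanSpace.single i 1)

theorem lapE_eq_pd (u : EuclideanSpace ℝ (Fin d) → ℝ) (x : EuclideanSpace ℝ (Fin d)) :
    lapE u x = ∑ i, pd i (pd i u) x := rfl

theorem pd_mul (i : Fin d) {f g : EuclideanSpace ℝ (Fin d) → ℝ} {y : EuclideanSpace ℝ (Fin d)}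
    (hf : DifferentiableAt ℝ f y) (hg : DifferentiableAt ℝ g y) :
    pd i (fun y => f y * g y) y = f y * pd i g y + g y * pd i f y := by
  unfold pd
  rw [fderiv_fun_mul hf hg]; simp

theorem pd_add (i : Fin d) {f g : EuclideanSpace ℝ (Fin d) → ℝ} {y : EuclideanSpace ℝ (Fin d)}
    (hf : DifferentiableAt ℝ f y) (hg : DifferentiableAt ℝ g y) :
    pd i (fun y => f y + g y) y = pd i f y + pd i g y := by
  unfold pd
  rw [fderiv_fun_add hf hg]; simp

theorem pd_const_mul (i : Fin d) (c : ℝ) (f : EuclideanSpace ℝ (Fin d) → ℝ) (y : EuclideanSpace ℝ (Fin d)) :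
    pd i (fun y => c * f y) y = c * pd i f y := by
  unfold pd
  have : (fun y => c * f y) = c • f := rfl
  rw [this, fderiv_const_smul_field]; simp

theorem pd_coord (i : Fin d) (y : EuclideanSpace ℝ (Fin d)) : pd i (fun y => y i) y = 1 := by
  unfold pd
  have h : HasFDerivAt (fun y : EuclideanSpace ℝ (Fin d) => y i)
      (EuclideanSpace.proj i : EuclideanSpace ℝ (Fin d) →L[ℝ] ℝ) y :=
      (EuclideanSpace.proj (𝕜 := ℝ) i).hasFDerivAt
  rw [h.fderiv]; simp

theorem lapE_const_mul (c : ℝ) (f : EuclideanSpace ℝ (Fin d) → ℝ) (y : EuclideanSpace ℝ (Fin d)) :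
    lapE (fun y => c * f y) y = c * lapE f y := by
  simp_rw [lapE_eq_pd, Finset.mul_sum]
  refine Finset.sum_congr rfl fun i _ => ?_
  rw [← pd_const_mul]
  congr 1
  ext z; exact pd_const_mul i c f z

theorem pd_normsq (i : Fin d) (j : ℕ) (y : EuclideanSpace ℝ (Fin d)) :
    pd i (fun y => (‖y‖ ^ 2) ^ j) y = 2 * j * (y i * (‖y‖ ^ 2) ^ (j - 1)) := by
  unfold pd
  have h1 := (hasDerivAt_pow j (‖y‖ ^ 2)).comp_hasFDerivAt y (hasStrictFDerivAt_norm_sq y).hasFDerivAt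
  have h2 : HasFDerivAt (fun y : EuclideanSpace ℝ (Fin d) => (‖y‖ ^ 2) ^ j) _ y := h1
  rw [h2.fderiv]
  simp [EuclideanSpace.inner_single_right]
  ring

/-- monomials -/
noncomputable def mon (α : Fin d → ℕ) (y : EuclideanSpace ℝ (Fin d)) : ℝ := ∏ k, y k ^ α k

theorem mon_cd (α : Fin d → ℕ) : ContDiff ℝ 2 (mon α) := by
  unfold mon
  apply contDiff_prod
  intro k _
  exact ContDiff.pow (EuclideanSpace.proj (𝕜 := ℝ) k : EuclideanSpace ℝ (Fin d) →L[ℝ] ℝ).contDiff _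

theorem mon_diff (α : Fin d → ℕ) : Differentiable ℝ (mon α) := (mon_cd α).differentiable (by norm_num)

theorem ns_diff (j : ℕ) : Differentiable ℝ (fun y : EuclideanSpace ℝ (Fin d) => (‖y‖ ^ 2) ^ j) := by
  have : ContDiff ℝ 1 (fun y : EuclideanSpace ℝ (Fin d) => ‖y‖ ^ 2) := contDiff_id.norm_sq ℝ
  exact (this.pow j).differentiable (by norm_num)

theorem co_diff (i : Fin d) : Differentiable ℝ (fun y : EuclideanSpace ℝ (Fin d) => y i) :=
  (EuclideanSpace.proj (𝕜 := ℝ) i : EuclideanSpace ℝ (Fin d) →L[ℝ] ℝ).differentiable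

theorem mon_split (α : Fin d → ℕ) (i : Fin d) (y : EuclideanSpace ℝ (Fin d)) :
    mon α y = y i ^ α i * ∏ k ∈ Finset.univ.erase i, y k ^ α k := by
  unfold mon
  exact (Finset.mul_prod_erase Finset.univ (fun k => y k ^ α k) (Finset.mem_univ i)).symm

theorem mon_update (α : Fin d → ℕ) (i : Fin d) (a : ℕ) (y : EuclideanSpace ℝ (Fin d)) :
    mon (Function.update α i a) y = y i ^ a * ∏ k ∈ Finset.univ.erase i, y k ^ α k := by
  rw [mon_split _ i]
  congr 1
  · simp
  · refine Finset.prod_congr rfl fun k hk => ?_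
    rw [Function.update_of_ne (Finset.ne_of_mem_erase hk)]

theorem pd_mon (i : Fin d) (α : Fin d → ℕ) (y : EuclideanSpace ℝ (Fin d)) :
    pd i (mon α) y = α i * mon (Function.update α i (α i - 1)) y := by
  have h : HasFDerivAt (mon α) (∑ k, (∏ l ∈ Finset.univ.erase k, y l ^ α l) •
      ((α k * y k ^ (α k - 1)) • (EuclideanSpace.proj k : EuclideanSpace ℝ (Fin d) →L[ℝ] ℝ))) y := by
    have := HasFDerivAt.finsetProd (u := Finset.univ) (x := y)
      (g := fun (k : Fin d) (y : EuclideanSpace ℝ (Fin d)) => y k ^ α k)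
      (g' := fun k => ((α k * y k ^ (α k - 1)) • (EuclideanSpace.proj k : EuclideanSpace ℝ (Fin d) →L[ℝ] ℝ)))
      (fun k _ => (hasDerivAt_pow (α k) (y k)).comp_hasFDerivAt (f := fun y : EuclideanSpace ℝ (Fin d) => y k) y
        (EuclideanSpace.proj (𝕜 := ℝ) k : EuclideanSpace ℝ (Fin d) →L[ℝ] ℝ).hasFDerivAt)
    exact this
  unfold pd
  rw [h.fderiv, mon_update]
  simp
  ring

theorem coord_pd_mon (i : Fin d) (α : Fin d → ℕ) (y : EuclideanSpace ℝ (Fin d)) :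
    y i * pd i (mon α) y = α i * mon α y := by
  rw [pd_mon, mon_update, mon_split α i]
  rcases h : α i with _ | n
  · simp
  · simp; ring

theorem pd_pd_mon (i : Fin d) (α : Fin d → ℕ) (y : EuclideanSpace ℝ (Fin d)) :
    pd i (pd i (mon α)) y = (α i * (α i - 1 : ℕ) : ℝ) * mon (Function.update α i (α i - 2)) y := by
  have : pd i (mon α) = fun y => (α i : ℝ) * mon (Function.update α i (α i - 1)) y := by
    ext y; exact pd_mon i α y
  rw [this, pd_const_mul, pd_mon]
  simp [Nat.sub_sub]
  ring

theorem lapE_mon (α : Fin d → ℕ) (x : EuclideanSpace ℝ (Fin d)) :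
    lapE (mon α) x = ∑ i, (α i * (α i - 1 : ℕ) : ℝ) * mon (Function.update α i (α i - 2)) x := by
  rw [lapE_eq_pd]; simp_rw [pd_pd_mon]

theorem lapE_mon_ns (α : Fin d → ℕ) (j : ℕ) (x : EuclideanSpace ℝ (Fin d)) :
    lapE (fun y => mon α y * (‖y‖ ^ 2) ^ j) x = lapE (mon α) x * (‖x‖ ^ 2) ^ j +
      (2 * j * (2 * (∑ k, α k : ℕ) + d + 2 * ((j - 1 : ℕ) : ℝ))) * (mon α x * (‖x‖ ^ 2) ^ (j - 1)) := by
  have hpd : ∀ i, Differentiable ℝ (pd i (mon α)) := fun i => by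
    have : pd i (mon α) = fun y => (α i : ℝ) * mon (Function.update α i (α i - 1)) y := by
      ext y; exact pd_mon i α y
    rw [this]; exact (mon_diff _).const_mul _
  have key : ∀ i, pd i (pd i (fun y => mon α y * (‖y‖ ^ 2) ^ j)) x =
      pd i (pd i (mon α)) x * (‖x‖ ^ 2) ^ j + 4 * j * (x i * pd i (mon α) x) * (‖x‖ ^ 2) ^ (j-1)
       + 2 * j * mon α x * (‖x‖ ^ 2) ^ (j-1) +
       4 * j * ((j - 1 : ℕ) : ℝ) * mon α x * (‖x‖ ^ 2) ^ (j-1-1) * (x i)^2 := by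
    intro i
    have h1 : pd i (fun y => mon α y * (‖y‖ ^ 2) ^ j) = fun y =>
        mon α y * (2 * j * (y i * (‖y‖ ^ 2) ^ (j - 1))) + (‖y‖ ^ 2) ^ j * pd i (mon α) y := by
      ext y
      rw [pd_mul i (mon_diff α y) (ns_diff j y), pd_normsq]
    have hc := co_diff i x
    have hn := ns_diff (d := d) (j-1) x
    rw [h1, pd_add i ((mon_diff α x).fun_mul ((hc.fun_mul hn).const_mul _)) ((ns_diff j x).fun_mul (hpd i x)),
      pd_mul i (mon_diff α x) ((hc.fun_mul hn).const_mul _), pd_const_mul, pd_mul i hc hn, pd_coord,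
      pd_mul i (ns_diff j x) (hpd i x), pd_normsq, pd_normsq]
    ring
  rw [lapE_eq_pd, lapE_eq_pd]
  simp_rw [key, coord_pd_mon]
  rw [Finset.sum_add_distrib, Finset.sum_add_distrib, Finset.sum_add_distrib, ← Finset.sum_mul,
    ← Finset.mul_sum, ← Finset.sum_mul, ← Finset.mul_sum, ← Finset.mul_sum]
  have hs : ∑ i, (x i)^2 = ‖x‖^2 := by
    rw [EuclideanSpace.norm_sq_eq]; simp
  rw [hs, ← Finset.sum_mul]
  push_cast
  simp only [Finset.sum_const, Finset.card_univ, Fintype.card_fin, nsmul_eq_mul]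
  rcases j with _ | _ | j
  · simp
  · simp; ring
  · simp; ring

end Mono
section Ell
/-- the ell-one space -/
abbrev L1 (I : Type) := lp (fun _ : I => ℝ) 1

variable {I : Type} [DecidableEq I]

/-- basis vectors -/
noncomputable def eb (i : I) : L1 I := lp.single 1 i (1 : ℝ)

theorem norm_eb (i : I) : ‖eb i‖ = 1 := by
  unfold eb; rw [lp.norm_single (by norm_num)]; simp

theorem L1_norm (a : L1 I) : HasSum (fun i => ‖a i‖) ‖a‖ := by
  have := lp.hasSum_norm (p := 1) (by norm_num) a
  simpa using this

theorem L1_ext {X : Type*} [NormedAddCommGroup X] [NormedSpace ℝ X] {S T : L1 I →L[ℝ] X}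
    (h : ∀ i, S (eb i) = T (eb i)) : S = T := by
  refine lp.ext_continuousLinearMap ENNReal.one_ne_top fun i => ?_
  ext
  exact h i

theorem L1_lift {X : Type*} [NormedAddCommGroup X] [NormedSpace ℝ X] [CompleteSpace X]
    (v : I → X) (C : ℝ) (hC0 : 0 ≤ C) (hC : ∀ i, ‖v i‖ ≤ C) :
    ∃ T : L1 I →L[ℝ] X, (∀ i, T (eb i) = v i) ∧ ‖T‖ ≤ C := by
  have hb : ∀ (a : L1 I) i, ‖a i • v i‖ ≤ ‖a i‖ * C := fun a i => by
    rw [norm_smul]; exact mul_le_mul_of_nonneg_left (hC i) (norm_nonneg _)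
  have hs : ∀ a : L1 I, Summable (fun i => a i • v i) := fun a =>
    Summable.of_norm_bounded ((L1_norm a).mul_right C).summable (hb a)
  let T0 : L1 I →ₗ[ℝ] X :=
    { toFun := fun a => ∑' i, a i • v i
      map_add' := by
        intro a b
        rw [← (hs a).tsum_add (hs b)]
        simp [add_smul]
      map_smul' := by
        intro c a
        rw [RingHom.id_apply, ← (hs a).tsum_const_smul]
        simp [mul_smul] }
  have hT0 : ∀ a, ‖T0 a‖ ≤ C * ‖a‖ := by
    intro a
    rw [mul_comm]
    exact tsum_of_norm_bounded ((L1_norm a).mul_right C) (hb a)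
  refine ⟨T0.mkContinuous C hT0, fun i => ?_, LinearMap.mkContinuous_norm_le _ hC0 _⟩
  change ∑' k, (eb i : L1 I) k • v k = v i
  rw [tsum_eq_single i]
  · simp [eb]
  · intro k hk
    simp [eb, lp.single_apply, Pi.single_apply, hk]

end Ell

section Idx
variable {d : ℕ}
/-- multi-indices -/
abbrev Ix (d : ℕ) := (Fin d → ℕ) × ℕ

/-- degree -/
def dg (α : Fin d → ℕ) : ℕ := ∑ k, α k

/-- binomial weight -/
def bi (i : Ix d) : ℕ := (dg i.1 + i.2).choose i.2

theorem bi_pos (i : Ix d) : 0 < bi i := Nat.choose_pos (by omega)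

theorem bi_mul (i j : Ix d) : bi i * bi j ≤ bi (i + j) := by
  unfold bi
  have h : dg (i + j).1 + (i + j).2 = (dg i.1 + i.2) + (dg j.1 + j.2) := by
    simp [dg, Finset.sum_add_distrib]; ring
  rw [h, Nat.add_choose_eq (dg i.1 + i.2) (dg j.1 + j.2) (i + j).2]
  exact Finset.single_le_sum (f := fun ij : ℕ × ℕ => (dg i.1 + i.2).choose ij.1 * (dg j.1 + j.2).choose ij.2)
    (fun _ _ => Nat.zero_le _) (a := (i.2, j.2)) (Finset.HasAntidiagonal.mem_antidiagonal.2 rfl)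

theorem bi_le (i : Ix d) : bi i ≤ 2 ^ (dg i.1 + i.2) := Nat.choose_le_two_pow _ _

theorem bi_succ (α : Fin d → ℕ) (j : ℕ) : bi (α, j) ≤ bi (α, j+1) := by
  unfold bi
  simp only
  rw [← add_assoc, Nat.choose_succ_succ]; omega

theorem choose_id (n j : ℕ) : (n + 2 + j).choose j * ((n + 2) * (n + 1)) =
    (n + (j+1)).choose (j+1) * ((n + 2 + j) * (j + 1)) := by
  have h1 := Nat.choose_mul_succ_eq (n + j + 1) j
  have h2 := Nat.choose_succ_right_eq (n + j + 1) j
  have e1 : n + j + 1 + 1 - j = n + 2 := by omega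
  have e2 : n + j + 1 - j = n + 1 := by omega
  have e3 : n + 2 + j = n + j + 1 + 1 := by ring
  have e4 : n + (j + 1) = n + j + 1 := by ring
  rw [e1] at h1
  rw [e2] at h2
  rw [e3, e4]
  calc _ = (n + j + 1 + 1).choose j * (n+2) * (n+1) := by ring
    _ = (n + j + 1).choose j * (n+1) * (n + j + 1 + 1) := by rw [← h1]; ring
    _ = _ := by rw [← h2]; ring

theorem dg_update (α : Fin d → ℕ) (k : Fin d) (h : 2 ≤ α k) :
    dg (Function.update α k (α k - 2)) + 2 = dg α := by
  unfold dg
  rw [← Finset.add_sum_erase _ _ (Finset.mem_univ k), ← Finset.add_sum_erase _ α (Finset.mem_univ k)]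
  have : ∑ x ∈ Finset.univ.erase k, Function.update α k (α k - 2) x = ∑ x ∈ Finset.univ.erase k, α x :=
    Finset.sum_congr rfl fun x hx => by rw [Function.update_of_ne (Finset.ne_of_mem_erase hx)]
  rw [this]
  simp
  omega

theorem le_dg (α : Fin d → ℕ) (k : Fin d) : α k ≤ dg α :=
  Finset.single_le_sum (f := α) (fun _ _ => Nat.zero_le _) (Finset.mem_univ k)

/-- multiplication -/
theorem exists_mul (d : ℕ) : ∃ M : L1 (Ix d) →L[ℝ] L1 (Ix d) →L[ℝ] L1 (Ix d), ‖M‖ ≤ 1 ∧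
    ∀ i j, M (eb i) (eb j) = ((bi i * bi j : ℝ) / bi (i + j)) • eb (i + j) := by
  have hn : ∀ i j : Ix d, ‖((bi i * bi j : ℝ) / bi (i + j)) • (eb (i + j) : L1 (Ix d))‖ ≤ 1 := by
    intro i j
    have h0 := bi_pos (i + j)
    rw [norm_smul, norm_eb, mul_one, Real.norm_of_nonneg (by positivity), div_le_one (by exact_mod_cast h0)]
    exact_mod_cast bi_mul i j
  choose R hR1 hR2 using fun i : Ix d => L1_lift (fun j : Ix d =>
    ((bi i * bi j : ℝ) / bi (i + j)) • (eb (i + j) : L1 (Ix d))) 1 zero_le_one (hn i)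
  obtain ⟨M, hM1, hM2⟩ := L1_lift R 1 zero_le_one hR2
  exact ⟨M, hM2, fun i j => by rw [hM1, hR1]⟩

/-- the eigenvalue -/
noncomputable def lam (d : ℕ) (i : Ix d) : ℝ := 2 * i.2 * (2 * (dg i.1 : ℝ) + d + 2 * ((i.2 - 1 : ℕ) : ℝ))

/-- weight -/
noncomputable def W (a b : ℝ) (i : Ix d) : ℝ := bi i * a ^ dg i.1 * b ^ i.2

theorem exists_S (hd : 2 ≤ d) (a b : ℝ) (ha : 0 < a) (hb : 0 < b) :
    ∃ S : L1 (Ix d) →L[ℝ] L1 (Ix d), ‖S‖ ≤ b⁻¹ ∧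
      ∀ α j, S (eb (α, j)) = (W a b (α, j) / (W a b (α, j+1) * lam d (α, j+1))) • eb (α, j+1) := by
  obtain ⟨S, h1, h2⟩ := L1_lift (fun i : Ix d =>
    (W a b i / (W a b (i.1, i.2+1) * lam d (i.1, i.2+1))) • (eb (i.1, i.2+1) : L1 (Ix d))) b⁻¹ (by positivity) (by
      rintro ⟨α, j⟩
      simp only
      have hbi : (0:ℝ) < bi (α, j+1) := by exact_mod_cast bi_pos _
      have hbi2 : (bi (α, j) : ℝ) ≤ bi (α, j+1) := by exact_mod_cast bi_succ α j
      have hdd : (2:ℝ) ≤ d := by exact_mod_cast hd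
      have hl : 1 ≤ lam d (α, j+1) := by
        simp only [lam]
        push_cast
        have hx : (0:ℝ) ≤ j := by positivity
        have hy : (0:ℝ) ≤ dg α := by positivity
        have h1 : (2:ℝ) ≤ 2 * (dg α : ℝ) + d + 2 * ((j + 1 - 1 : ℕ) : ℝ) := by
          have : (0:ℝ) ≤ ((j + 1 - 1 : ℕ) : ℝ) := by positivity
          linarith
        nlinarith
      rw [norm_smul, norm_eb, mul_one, Real.norm_of_nonneg (by simp only [W]; positivity)]
      rw [div_le_iff₀ (by simp only [W]; positivity)]
      simp only [W]
      have : b⁻¹ * (bi (α, j+1) * a ^ dg α * b ^ (j+1) * lam d (α, j+1)) =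
         (bi (α, j+1) * a ^ dg α * b ^ j) * lam d (α, j+1) := by
        field_simp
        ring
      rw [this]
      calc (bi (α, j) : ℝ) * a ^ dg α * b ^ j ≤ bi (α, j+1) * a ^ dg α * b ^ j := by gcongr
        _ ≤ _ := le_mul_of_one_le_right (by positivity) hl)
  exact ⟨S, h2, fun α j => h1 (α, j)⟩

theorem exists_K (hd : 2 ≤ d) (a b : ℝ) (ha : 0 < a) (hb : 0 < b) :
    ∃ K : L1 (Ix d) →L[ℝ] L1 (Ix d), ‖K‖ ≤ d * (a ^ 2 * b⁻¹) ∧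
      ∀ α j, K (eb (α, j)) = ∑ k, ((W a b (α, j) * (α k * (α k - 1 : ℕ))) /
        (W a b (Function.update α k (α k - 2), j+1) * lam d (Function.update α k (α k - 2), j+1)))
         • eb (Function.update α k (α k - 2), j+1) := by
  obtain ⟨S, h1, h2⟩ := L1_lift (fun i : Ix d =>
    ∑ k, ((W a b i * (i.1 k * (i.1 k - 1 : ℕ))) /
        (W a b (Function.update i.1 k (i.1 k - 2), i.2+1) * lam d (Function.update i.1 k (i.1 k - 2), i.2+1)))
         • (eb (Function.update i.1 k (i.1 k - 2), i.2+1) : L1 (Ix d))) (d * (a ^ 2 * b⁻¹)) (by positivity) (by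
      rintro ⟨α, j⟩
      simp only
      have : (d * (a ^ 2 * b⁻¹) : ℝ) = ∑ k : Fin d, (a ^ 2 * b⁻¹) := by simp
      rw [this]
      refine norm_sum_le_of_le _ fun k _ => ?_
      rw [norm_smul, norm_eb, mul_one, Real.norm_of_nonneg (by simp only [W, lam]; positivity)]
      by_cases hk : 2 ≤ α k
      swap
      · have : α k * (α k - 1) = 0 := by
          have : α k = 0 ∨ α k = 1 := by omega
          rcases this with h | h <;> simp [h]
        have h' : (α k * (α k - 1 : ℕ) : ℝ) = 0 := by exact_mod_cast this
        rw [h']; simp; positivity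
      have hdg := dg_update α k hk
      set β := Function.update α k (α k - 2) with hβ
      have hle := le_dg α k
      have hle2 : α k * (α k - 1) ≤ (dg β + 2) * (dg β + 1) := by
        apply Nat.mul_le_mul <;> omega
      have hid := choose_id (dg β) j
      have hid' : bi (α, j) * ((dg β + 2) * (dg β + 1)) = bi (β, j+1) * ((dg β + 2 + j) * (j+1)) := by
        simp only [bi]; rw [← hdg]; exact hid
      have hidR : (bi (α, j) : ℝ) * ((dg β + 2) * (dg β + 1)) = bi (β, j+1) * ((dg β + 2 + j) * (j+1)) := by
        exact_mod_cast hid'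
      have hle2R : (α k * (α k - 1 : ℕ) : ℝ) ≤ (dg β + 2) * (dg β + 1) := by exact_mod_cast hle2
      have hbi : (0:ℝ) < bi (β, j+1) := by exact_mod_cast bi_pos _
      have hdd : (2:ℝ) ≤ d := by exact_mod_cast hd
      have hx : (0:ℝ) ≤ j := by positivity
      have hy : (0:ℝ) ≤ dg β := by positivity
      have hlam : lam d (β, j+1) = 2 * (j+1) * (2 * (dg β : ℝ) + d + 2 * j) := by
        simp [lam]
      rw [div_le_iff₀ (by rw [hlam]; simp only [W]; positivity), hlam]
      simp only [W]
      rw [← hdg]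
      have : a ^ 2 * b⁻¹ * (bi (β, j+1) * a ^ dg β * b ^ (j+1) * (2 * (j+1) * (2 * (dg β : ℝ) + d + 2 * j)))
        = a ^ (dg β + 2) * b ^ j * (bi (β, j+1) * (2 * (j+1) * (2 * (dg β : ℝ) + d + 2 * j))) := by
        field_simp
        ring
      rw [this]
      calc (bi (α, j) : ℝ) * a ^ (dg β + 2) * b ^ j * (α k * (α k - 1 : ℕ))
          ≤ (bi (α, j) : ℝ) * a ^ (dg β + 2) * b ^ j * ((dg β + 2) * (dg β + 1)) := by gcongr
        _ = a ^ (dg β + 2) * b ^ j * (bi (β, j+1) * ((dg β + 2 + j) * (j+1))) := by rw [← hidR]; ring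
        _ ≤ _ := by
          gcongr _ * (_ * ?_)
          nlinarith)
  exact ⟨S, h2, fun α j => h1 (α, j)⟩

end Idx
section Eval
open scoped BoundedContinuousFunction
variable {d : ℕ}

/-- bounded families -/
abbrev BX (d : ℕ) := Ix d →ᵇ ℝ

theorem exists_bx (c : Ix d → ℝ) (C : ℝ) (h : ∀ i, |c i| ≤ C) :
    ∃ φ : BX d, (∀ i, φ i = c i) ∧ ‖φ‖ ≤ C :=
  ⟨BoundedContinuousFunction.ofNormedAddCommGroupDiscrete c C h, fun _ => rfl,
    (BoundedContinuousFunction.norm_le ((abs_nonneg _).trans (h (0, 0)))).2 h⟩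

theorem exists_gam (κ : Ix d → ℕ) (c : Ix d → ℝ) (C r : ℝ) (hr : 0 < r)
    (hc : ∀ i, |c i| ≤ C * r ^ κ i) :
    ∃ γ : ℝ → BX d, AnalyticAt ℝ γ 0 ∧ ∀ᶠ t in 𝓝 (0:ℝ), ∀ i, γ t i = c i * t ^ κ i := by
  have hC : 0 ≤ C := by
    have h1 := (abs_nonneg _).trans (hc (0, 0))
    exact nonneg_of_mul_nonneg_left h1 (by positivity)
  choose b hb1 hb2 using fun n : ℕ => exists_bx (fun i : Ix d => if κ i = n then c i else 0) (C * r ^ n) (by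
    intro i
    by_cases h : κ i = n
    · simpa [h] using hc i
    · simp [h]; positivity)
  let p : FormalMultilinearSeries ℝ ℝ (BX d) := fun n => ContinuousMultilinearMap.mkPiRing ℝ (Fin n) (b n)
  let r' : NNReal := ⟨r⁻¹, by positivity⟩
  have hr' : (r' : ENNReal) ≤ p.radius := by
    refine p.le_radius_of_bound C fun n => ?_
    simp only [p, ContinuousMultilinearMap.norm_mkPiRing]
    calc ‖b n‖ * (r⁻¹) ^ n ≤ C * r ^ n * (r⁻¹) ^ n := by gcongr; exact hb2 n
      _ = C := by rw [mul_assoc, ← mul_pow, mul_inv_cancel₀ hr.ne', one_pow, mul_one]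
  have hpos : 0 < p.radius := lt_of_lt_of_le (by
    simp only [ENNReal.coe_pos]; exact NNReal.coe_pos.1 (show 0 < r⁻¹ by positivity)) hr'
  have hp := p.hasFPowerSeriesOnBall hpos
  refine ⟨p.sum, hp.analyticAt, ?_⟩
  have := hp.eventually_hasSum
  filter_upwards [this] with t ht i
  have h1 := (BoundedContinuousFunction.evalCLM ℝ i : BX d →L[ℝ] ℝ).hasSum ht
  simp only [p, zero_add] at h1
  have h2 : HasSum (fun n => ((BoundedContinuousFunction.evalCLM ℝ i : BX d →L[ℝ] ℝ)
     ((ContinuousMultilinearMap.mkPiRing ℝ (Fin n) (b n)) fun _ => t))) (c i * t ^ κ i) := by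
    convert hasSum_single (κ i) ?_ using 1
    · simp [hb1, mul_comm]
    · intro n hn
      simp [hb1, Ne.symm hn]
  exact h1.unique h2

theorem exists_theta (a b : ℝ) (ha : 0 < a) (hb : 0 < b) (s : ℕ) :
    ∃ Θ : EuclideanSpace ℝ (Fin d) × ℝ → BX d, AnalyticAt ℝ Θ 0 ∧
      ∀ᶠ z in 𝓝 (0 : EuclideanSpace ℝ (Fin d) × ℝ), ∀ i,
        Θ z i = if i.2 < s then 0 else W a b i * (mon i.1 z.1 * z.2 ^ (i.2 - s)) := by
  choose γ hγ1 hγ2 using fun k : Fin d => exists_gam (fun i : Ix d => i.1 k) (fun i => (2*a)^(i.1 k)) 1 (2*a)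
    (by positivity) (fun i => by rw [abs_of_nonneg (by positivity), one_mul])
  obtain ⟨γs, hs1, hs2⟩ := exists_gam (fun i : Ix d => i.2 - s) (fun i => if i.2 < s then 0 else (2*b)^i.2)
    ((2*b)^s) (2*b) (by positivity) (fun i => by
      by_cases h : i.2 < s
      · simp only [h, if_true]; simp; positivity
      · simp only [h, if_false]; rw [abs_of_nonneg (by positivity), ← pow_add]
        apply le_of_eq; congr 1; omega)
  obtain ⟨β, hβ, -⟩ := exists_bx (fun i : Ix d => bi i * ((2:ℝ)⁻¹) ^ (dg i.1 + i.2)) 1 (fun i => by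
    rw [abs_of_nonneg (by positivity), inv_pow, mul_inv_le_iff₀ (by positivity), one_mul]
    exact_mod_cast bi_le i)
  refine ⟨fun z => β * (∏ k, γ k (z.1 k)) * γs z.2, ?_, ?_⟩
  · have h1 : ∀ k, AnalyticAt ℝ (fun z : EuclideanSpace ℝ (Fin d) × ℝ => γ k (z.1 k)) 0 := by
      intro k
      refine AnalyticAt.fun_comp (g := γ k) (f := fun z : EuclideanSpace ℝ (Fin d) × ℝ => z.1 k) ?_ ?_
      · simpa using hγ1 k
      · exact ((EuclideanSpace.proj k).comp (ContinuousLinearMap.fst ℝ (EuclideanSpace ℝ (Fin d)) ℝ)).analyticAt _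
    have h2 : AnalyticAt ℝ (fun z : EuclideanSpace ℝ (Fin d) × ℝ => γs z.2) 0 := by
      refine AnalyticAt.fun_comp (g := γs) (f := fun z : EuclideanSpace ℝ (Fin d) × ℝ => z.2) ?_ ?_
      · simpa using hs1
      · exact analyticAt_snd
    refine (analyticAt_const.mul ?_).mul h2
    exact Finset.analyticAt_fun_prod _ fun k _ => h1 k
  · have h1 : ∀ᶠ z in 𝓝 (0 : EuclideanSpace ℝ (Fin d) × ℝ), ∀ k, ∀ i, γ k (z.1 k) i = (2*a)^(i.1 k) * (z.1 k) ^ (i.1 k) := by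
      rw [eventually_all]
      intro k
      have : Tendsto (fun z : EuclideanSpace ℝ (Fin d) × ℝ => z.1 k) (𝓝 0) (𝓝 0) := by
        have : Continuous (fun z : EuclideanSpace ℝ (Fin d) × ℝ => z.1 k) := by fun_prop
        simpa using this.tendsto 0
      exact this.eventually (hγ2 k)
    have h2 : Tendsto (fun z : EuclideanSpace ℝ (Fin d) × ℝ => z.2) (𝓝 0) (𝓝 0) := by
      have : Continuous (fun z : EuclideanSpace ℝ (Fin d) × ℝ => z.2) := by fun_prop
      simpa using this.tendsto 0
    filter_upwards [h1, h2.eventually hs2] with z hz1 hz2 i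
    have e1 : (∏ k, γ k (z.1 k)) i = ∏ k, (γ k (z.1 k)) i := by
      have hg : ∀ t : Finset (Fin d), (∏ k ∈ t, γ k (z.1 k)) i = ∏ k ∈ t, (γ k (z.1 k)) i := by
        intro t
        induction t using Finset.induction_on with
        | empty => simp
        | insert k t hk ih => rw [Finset.prod_insert hk, Finset.prod_insert hk, BoundedContinuousFunction.mul_apply, ih]
      exact hg _
    simp only [BoundedContinuousFunction.mul_apply, e1, hβ, hz2, hz1]
    by_cases h : i.2 < s
    · simp [h]
    · simp only [h, if_false, W, mon]
      rw [Finset.prod_mul_distrib, Finset.prod_pow_eq_pow_sum]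
      change _ * (_ ^ dg i.1 * _) * _ = _
      rw [mul_pow, mul_pow, pow_add]
      have : (2:ℝ) ^ dg i.1 * 2⁻¹ ^ dg i.1 = 1 := by rw [← mul_pow]; norm_num
      have h' : (2:ℝ) ^ i.2 * 2⁻¹ ^ i.2 = 1 := by rw [← mul_pow]; norm_num
      calc _ = ((2:ℝ) ^ dg i.1 * 2⁻¹ ^ dg i.1) * ((2:ℝ) ^ i.2 * 2⁻¹ ^ i.2) * (bi i * a ^ dg i.1 * b ^ i.2 * ((∏ k, z.1 k ^ i.1 k) * z.2 ^ (i.2 - s))) := by ring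
        _ = _ := by rw [this, h']; ring

theorem lapE_clm {V V' : Type*} [NormedAddCommGroup V] [NormedSpace ℝ V] [NormedAddCommGroup V'] [NormedSpace ℝ V']
    (L : V →L[ℝ] V') (u : EuclideanSpace ℝ (Fin d) → V) (x : EuclideanSpace ℝ (Fin d))
    (hu : ContDiffAt ℝ 2 u x) : lapE (fun y => L (u y)) x = L (lapE u x) := by
  unfold lapE
  rw [map_sum]
  refine Finset.sum_congr rfl fun i _ => ?_
  have h1 : ∀ᶠ y in 𝓝 x, DifferentiableAt ℝ u y := by
    have := hu.eventually (by simp)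
    filter_upwards [this] with y hy using hy.differentiableAt (by norm_num)
  have h2 : (fun y => fderiv ℝ (fun y => L (u y)) y (EuclideanSpace.single i 1)) =ᶠ[𝓝 x]
     fun y => L (fderiv ℝ u y (EuclideanSpace.single i 1)) := by
    filter_upwards [h1] with y hy
    have := (L.hasFDerivAt.comp y hy.hasFDerivAt).fderiv
    change fderiv ℝ (L ∘ u) y _ = _
    rw [this]; rfl
  rw [h2.fderiv_eq]
  have h3 : DifferentiableAt ℝ (fun y => fderiv ℝ u y (EuclideanSpace.single i 1)) x := by
    have := (hu.fderiv_right (m := 1) (by norm_num)).differentiableAt (by norm_num)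
    exact this.clm_apply (differentiableAt_const _)
  have := (L.hasFDerivAt.comp x h3.hasFDerivAt).fderiv
  change fderiv ℝ (L ∘ fun y => fderiv ℝ u y (EuclideanSpace.single i 1)) x _ = _
  rw [this]; rfl

theorem eval_family (a b : ℝ) (ha : 0 < a) (hb : 0 < b) :
    ∃ Φ Φ' : EuclideanSpace ℝ (Fin d) → BX d, AnalyticAt ℝ Φ 0 ∧ AnalyticAt ℝ Φ' 0 ∧
      ∀ᶠ x in 𝓝 (0 : EuclideanSpace ℝ (Fin d)), (∀ i, Φ x i = W a b i * (mon i.1 x * (‖x‖ ^ 2) ^ i.2)) ∧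
        (∀ i, Φ' x i = if i.2 < 1 then 0 else W a b i * (mon i.1 x * (‖x‖ ^ 2) ^ (i.2 - 1))) ∧
        ∃ Λ Ψ : BX d, lapE Φ x = Λ + Ψ ∧
          (∀ i, Ψ i = W a b i * (lapE (mon i.1) x * (‖x‖ ^ 2) ^ i.2)) ∧
          (∀ i, Λ i = W a b i * (lam d i * (mon i.1 x * (‖x‖ ^ 2) ^ (i.2 - 1)))) := by
  obtain ⟨Θ, hΘ1, hΘ2⟩ := exists_theta (d := d) a b ha hb 0
  obtain ⟨Θ', hΘ1', hΘ2'⟩ := exists_theta (d := d) a b ha hb 1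
  simp only [Nat.not_lt_zero, if_false, Nat.sub_zero] at hΘ2
  have hι : AnalyticAt ℝ (fun x : EuclideanSpace ℝ (Fin d) => (x, ‖x‖ ^ 2)) 0 := by
    refine analyticAt_id.prod ?_
    have : (fun x : EuclideanSpace ℝ (Fin d) => ‖x‖ ^ 2) = fun x => ∑ k, x k ^ 2 := by
      ext x; rw [EuclideanSpace.real_norm_sq_eq]
    rw [this]
    refine Finset.analyticAt_fun_sum _ fun k _ => ?_
    exact ((EuclideanSpace.proj k : EuclideanSpace ℝ (Fin d) →L[ℝ] ℝ).analyticAt _).pow 2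
  have hι0 : (fun x : EuclideanSpace ℝ (Fin d) => (x, ‖x‖ ^ 2)) 0 = 0 := by simp
  have hιt : Tendsto (fun x : EuclideanSpace ℝ (Fin d) => (x, ‖x‖ ^ 2)) (𝓝 0) (𝓝 0) := by
    have := hι.continuousAt.tendsto
    rw [show ((0 : EuclideanSpace ℝ (Fin d)), ‖(0 : EuclideanSpace ℝ (Fin d))‖ ^ 2) = 0 from hι0] at this
    exact this
  have hΦ : AnalyticAt ℝ (fun x : EuclideanSpace ℝ (Fin d) => Θ (x, ‖x‖ ^ 2)) 0 :=
    AnalyticAt.fun_comp (g := Θ) (by rw [show ((0 : EuclideanSpace ℝ (Fin d)), ‖(0 : EuclideanSpace ℝ (Fin d))‖ ^ 2) = 0 from hι0]; exact hΘ1) hι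
  have hΦ' : AnalyticAt ℝ (fun x : EuclideanSpace ℝ (Fin d) => Θ' (x, ‖x‖ ^ 2)) 0 :=
    AnalyticAt.fun_comp (g := Θ') (by rw [show ((0 : EuclideanSpace ℝ (Fin d)), ‖(0 : EuclideanSpace ℝ (Fin d))‖ ^ 2) = 0 from hι0]; exact hΘ1') hι
  refine ⟨_, _, hΦ, hΦ', ?_⟩
  filter_upwards [hιt.eventually hΘ2, hιt.eventually hΘ2', (hιt.eventually hΘ2.eventually_nhds),
    hιt.eventually hΘ1.eventually_analyticAt, hΦ.eventually_analyticAt, (hιt.eventually hΘ2).eventually_nhds] with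
    x hx1 hx2 hx3 hx4 hx5 hx6
  refine ⟨hx1, hx2, ?_⟩
  have hpair : AnalyticAt ℝ (fun y : EuclideanSpace ℝ (Fin d) => (y, ‖x‖ ^ 2)) x :=
    analyticAt_id.prod analyticAt_const
  have hA : AnalyticAt ℝ (fun y : EuclideanSpace ℝ (Fin d) => Θ (y, ‖x‖ ^ 2)) x :=
    AnalyticAt.fun_comp (g := Θ) hx4 hpair
  have hΨ : ∀ i, (lapE (fun y : EuclideanSpace ℝ (Fin d) => Θ (y, ‖x‖ ^ 2)) x) i =
      W a b i * (lapE (mon i.1) x * (‖x‖ ^ 2) ^ i.2) := by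
    intro i
    have := lapE_clm (BoundedContinuousFunction.evalCLM ℝ i : BX d →L[ℝ] ℝ) _ x (hA.contDiffAt (n := 2))
    simp only [BoundedContinuousFunction.evalCLM_apply] at this
    rw [← this]
    have he : (fun y : EuclideanSpace ℝ (Fin d) => Θ (y, ‖x‖ ^ 2) i) =ᶠ[𝓝 x]
        fun y => (W a b i * (‖x‖ ^ 2) ^ i.2) * mon i.1 y := by
      filter_upwards [hpair.continuousAt.tendsto.eventually hx3] with y hy
      rw [hy i]; ring
    rw [lapE_congr he, lapE_const_mul]; ring
  have hΦe : ∀ i, (lapE (fun y : EuclideanSpace ℝ (Fin d) => Θ (y, ‖y‖ ^ 2)) x) i =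
      W a b i * (lapE (mon i.1) x * (‖x‖ ^ 2) ^ i.2 + lam d i * (mon i.1 x * (‖x‖ ^ 2) ^ (i.2 - 1))) := by
    intro i
    have := lapE_clm (BoundedContinuousFunction.evalCLM ℝ i : BX d →L[ℝ] ℝ) _ x (hx5.contDiffAt (n := 2))
    simp only [BoundedContinuousFunction.evalCLM_apply] at this
    rw [← this]
    have he : (fun y : EuclideanSpace ℝ (Fin d) => Θ (y, ‖y‖ ^ 2) i) =ᶠ[𝓝 x]
        fun y => W a b i * (mon i.1 y * (‖y‖ ^ 2) ^ i.2) := by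
      filter_upwards [hx6] with y hy using hy i
    rw [lapE_congr he, lapE_const_mul, lapE_mon_ns]; simp only [lam, dg]
  refine ⟨lapE (fun y : EuclideanSpace ℝ (Fin d) => Θ (y, ‖y‖ ^ 2)) x - lapE (fun y : EuclideanSpace ℝ (Fin d) => Θ (y, ‖x‖ ^ 2)) x,
    _, (sub_add_cancel _ _).symm, hΨ, fun i => ?_⟩
  rw [BoundedContinuousFunction.sub_apply, hΦe, hΨ]; ring

theorem exists_T (d : ℕ) : ∃ T : L1 (Ix d) →L[ℝ] BX d →L[ℝ] ℝ, ∀ i φ, T (eb i) φ = φ i := by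
  obtain ⟨T, hT, -⟩ := L1_lift (fun i : Ix d => (BoundedContinuousFunction.evalCLM ℝ i : BX d →L[ℝ] ℝ)) 1 zero_le_one (by
    intro i
    refine ContinuousLinearMap.opNorm_le_bound _ zero_le_one fun φ => ?_
    rw [one_mul]; exact φ.norm_coe_le_norm i)
  exact ⟨T, fun i φ => by rw [hT]; rfl⟩
end Eval
section Nonlin
variable {A : Type*} [NormedAddCommGroup A] [NormedSpace ℝ A]

/-- powers -/
noncomputable def pw (M : A →L[ℝ] A →L[ℝ] A) (e : A) (U : A) : ℕ → A
  | 0 => e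
  | k + 1 => M U (pw M e U k)

theorem M_le (M : A →L[ℝ] A →L[ℝ] A) (hM : ‖M‖ ≤ 1) (U V : A) : ‖M U V‖ ≤ ‖U‖ * ‖V‖ := by
  calc ‖M U V‖ ≤ ‖M‖ * ‖U‖ * ‖V‖ := M.le_opNorm₂ U V
    _ ≤ 1 * ‖U‖ * ‖V‖ := by gcongr
    _ = _ := by ring

theorem pw_norm (M : A →L[ℝ] A →L[ℝ] A) (hM : ‖M‖ ≤ 1) (e : A) (he : ‖e‖ ≤ 1) (U : A) (R : ℝ) (hU : ‖U‖ ≤ R)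
    (k : ℕ) : ‖pw M e U k‖ ≤ R ^ k := by
  have hR := (norm_nonneg _).trans hU
  induction k with
  | zero => simpa [pw] using he
  | succ k ih =>
    calc ‖pw M e U (k+1)‖ ≤ ‖U‖ * ‖pw M e U k‖ := M_le M hM _ _
      _ ≤ R * R ^ k := by gcongr
      _ = _ := by ring

theorem pw_lip (M : A →L[ℝ] A →L[ℝ] A) (hM : ‖M‖ ≤ 1) (e : A) (he : ‖e‖ ≤ 1) (U V : A) (R : ℝ) (hU : ‖U‖ ≤ R)
    (hV : ‖V‖ ≤ R) (k : ℕ) : R * ‖pw M e U k - pw M e V k‖ ≤ k * R ^ k * ‖U - V‖ := by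
  have hR := (norm_nonneg _).trans hU
  induction k with
  | zero => simp [pw]
  | succ k ih =>
    have : pw M e U (k+1) - pw M e V (k+1) = M (U - V) (pw M e U k) + M V (pw M e U k - pw M e V k) := by
      simp [pw]
    rw [this]
    calc R * ‖M (U - V) (pw M e U k) + M V (pw M e U k - pw M e V k)‖
        ≤ R * (‖U - V‖ * ‖pw M e U k‖ + ‖V‖ * ‖pw M e U k - pw M e V k‖) := by
          gcongr
          exact (norm_add_le _ _).trans (add_le_add (M_le M hM _ _) (M_le M hM _ _))
      _ ≤ R * (‖U - V‖ * R ^ k + R * ‖pw M e U k - pw M e V k‖) := by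
          gcongr
          exact pw_norm M hM e he U R hU k
      _ = R * (‖U - V‖ * R ^ k) + R * (R * ‖pw M e U k - pw M e V k‖) := by ring
      _ ≤ R * (‖U - V‖ * R ^ k) + R * (k * R ^ k * ‖U - V‖) := by gcongr
      _ = _ := by push_cast; ring

theorem exists_F [CompleteSpace A] (M : A →L[ℝ] A →L[ℝ] A) (hM : ‖M‖ ≤ 1) (e : A) (he : ‖e‖ ≤ 1)
    (f : ℝ → ℝ) (hf : AnalyticAt ℝ f 0) :
    ∃ (R : ℝ) (F : A → A) (C1 : ℝ), 0 < R ∧ 0 ≤ C1 ∧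
      (∀ U V, ‖U‖ ≤ R → ‖V‖ ≤ R → ‖F U - F V‖ ≤ C1 * ‖U - V‖) ∧
      ∀ᶠ t in 𝓝 (0:ℝ), ∀ U, ‖U‖ ≤ R → ∀ L : A →L[ℝ] ℝ, L e = 1 → (∀ U V, L (M U V) = L U * L V) →
        L U = t → L (F U) = f t := by
  obtain ⟨p, hp⟩ := hf
  obtain ⟨C, Q, hC, hQ, hb⟩ := p.le_mul_pow_of_radius_pos hp.radius_pos
  have hco : ∀ n, ‖p.coeff n‖ ≤ C * Q ^ n := fun n => by
    rw [← p.norm_apply_eq_norm_coef]; exact hb n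
  set R : ℝ := (4 * Q)⁻¹ with hR
  have hR0 : 0 < R := by positivity
  have hQR : ∀ k : ℕ, Q ^ k * R ^ k = (1/4 : ℝ) ^ k := fun k => by
    rw [← mul_pow]; congr 1; rw [hR]; field_simp
  have hsg : Summable (fun k : ℕ => C * (1/4 : ℝ) ^ k) :=
    (summable_geometric_of_lt_one (by norm_num) (by norm_num)).mul_left C
  have hsl : Summable (fun k : ℕ => (k : ℝ) * (1/4 : ℝ) ^ k) := by
    have := summable_pow_mul_geometric_of_norm_lt_one 1 (r := (1/4 : ℝ)) (by norm_num)
    simpa using this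
  have hbd : ∀ U, ‖U‖ ≤ R → ∀ k, ‖p.coeff k • pw M e U k‖ ≤ C * (1/4 : ℝ) ^ k := by
    intro U hU k
    rw [norm_smul, ← hQR, ← mul_assoc]
    gcongr
    · exact hco k
    · exact pw_norm M hM e he U R hU k
  have hs : ∀ U, ‖U‖ ≤ R → Summable (fun k => p.coeff k • pw M e U k) := fun U hU =>
    Summable.of_norm_bounded hsg (hbd U hU)
  refine ⟨R, fun U => ∑' k, p.coeff k • pw M e U k, C / R * ∑' k : ℕ, (k : ℝ) * (1/4 : ℝ) ^ k, hR0,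
    mul_nonneg (by positivity) (tsum_nonneg fun k => by positivity), ?_, ?_⟩
  · intro U V hU hV
    simp only
    rw [← (hs U hU).tsum_sub (hs V hV)]
    have := (hsl.hasSum.mul_left (C / R)).mul_right ‖U - V‖
    refine tsum_of_norm_bounded this fun k => ?_
    rw [← smul_sub, norm_smul]
    have h1 := pw_lip M hM e he U V R hU hV k
    have h2 : ‖pw M e U k - pw M e V k‖ ≤ (k * R ^ k * ‖U - V‖) / R := by
      rw [le_div_iff₀ hR0]; linarith
    calc ‖p.coeff k‖ * ‖pw M e U k - pw M e V k‖ ≤ (C * Q ^ k) * ((k * R ^ k * ‖U - V‖) / R) := by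
          gcongr; exact hco k
      _ = C / R * (k * (Q ^ k * R ^ k)) * ‖U - V‖ := by ring
      _ = _ := by rw [hQR]
  · filter_upwards [hp.eventually_hasSum] with t ht U hU L h1 h2 h3
    have hLp : ∀ k, L (pw M e U k) = t ^ k := by
      intro k
      induction k with
      | zero => simpa [pw] using h1
      | succ k ih => simp only [pw]; rw [h2, ih, h3]; ring
    have h4 := L.hasSum (hs U hU).hasSum
    simp only [zero_add, FormalMultilinearSeries.apply_eq_pow_smul_coeff] at ht
    have he : ∀ k, L (p.coeff k • pw M e U k) = t ^ k • p.coeff k := fun k => by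
      rw [map_smul, hLp]
      simp [mul_comm]
    have h5 : HasSum (fun k => t ^ k • p.coeff k) (L (∑' k, p.coeff k • pw M e U k)) := by
      simpa only [he] using h4
    exact h5.unique ht
end Nonlin
section Init
variable {d : ℕ}

/-- content of a word -/
def cnt {n : ℕ} (w : Fin n → Fin d) : Fin d → ℕ := fun k => (Finset.univ.filter fun j => w j = k).card

theorem dg_cnt {n : ℕ} (w : Fin n → Fin d) : dg (cnt w) = n := by
  unfold dg cnt
  rw [← Finset.card_eq_sum_card_fiberwise (fun _ _ => Finset.mem_coe.2 (Finset.mem_univ _))]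
  simp

theorem mon_cnt {n : ℕ} (w : Fin n → Fin d) (x : EuclideanSpace ℝ (Fin d)) : mon (cnt w) x = ∏ j, x (w j) := by
  unfold mon cnt
  rw [← Finset.prod_fiberwise Finset.univ w]
  refine Finset.prod_congr rfl fun k _ => ?_
  rw [← Finset.prod_const]
  refine Finset.prod_congr rfl fun j hj => ?_
  rw [(Finset.mem_filter.1 hj).2]

theorem cml_expand {n : ℕ} (q : ContinuousMultilinearMap ℝ (fun _ : Fin n => EuclideanSpace ℝ (Fin d)) ℝ)
    (x : EuclideanSpace ℝ (Fin d)) :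
    q (fun _ => x) = ∑ w : Fin n → Fin d, q (fun j => EuclideanSpace.single (w j) 1) * ∏ j, x (w j) := by
  have hx : x = ∑ k, x k • EuclideanSpace.single k (1:ℝ) := by
    ext l
    simp [Pi.single_apply]
  conv_lhs => rw [hx]
  rw [q.map_sum]
  refine Finset.sum_congr rfl fun w _ => ?_
  rw [q.map_smul_univ (fun j => x (w j)) (fun j => EuclideanSpace.single (w j) (1:ℝ))]
  simp [mul_comm]

theorem exists_U0 (hd : 0 < d) (uL : EuclideanSpace ℝ (Fin d) → ℝ) (h : AnalyticAt ℝ uL 0) (h0 : uL 0 = 0)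
    (η : ℝ) (hη : 0 < η) :
    ∃ (a : ℝ) (U0 : L1 (Ix d)), 0 < a ∧ ‖U0‖ ≤ η ∧
      (∀ L : L1 (Ix d) →L[ℝ] ℝ, (∀ α, L (eb (α, 0)) = 0) → L U0 = 0) ∧
      ∀ᶠ x in 𝓝 (0 : EuclideanSpace ℝ (Fin d)), ∀ L : L1 (Ix d) →L[ℝ] ℝ,
        (∀ α, L (eb (α, 0)) = a ^ dg α * mon α x) → L U0 = uL x := by
  obtain ⟨p, hp⟩ := h
  obtain ⟨C, Q, hC, hQ, hb⟩ := p.le_mul_pow_of_radius_pos hp.radius_pos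
  have hp0 : p 0 = 0 := by
    ext v
    rw [hp.coeff_zero v, h0]; rfl
  have hdd : (0:ℝ) < d := by exact_mod_cast hd
  obtain ⟨q, hq0, hq1, hq2⟩ : ∃ q : ℝ, 0 < q ∧ q ≤ 1/2 ∧ 4 * C * q ≤ η := by
    refine ⟨min (1/2) (η / (4 * C)), by positivity, min_le_left _ _, ?_⟩
    calc 4 * C * min (1/2) (η / (4 * C)) ≤ 4 * C * (η / (4 * C)) := by gcongr; exact min_le_right _ _
      _ = η := by field_simp
  set a : ℝ := d * Q / q with ha
  have ha0 : 0 < a := by positivity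
  have hdq : (d:ℝ) * Q * a⁻¹ = q := by rw [ha]; field_simp
  let v : ℕ → L1 (Ix d) := fun n => ∑ w : Fin n → Fin d,
    (p n (fun j => EuclideanSpace.single (w j) 1) * (a⁻¹) ^ n) • eb (cnt w, 0)
  have hv : ∀ n, ‖v n‖ ≤ C * q ^ n := by
    intro n
    calc ‖v n‖ ≤ ∑ w : Fin n → Fin d, (C * Q ^ n * (a⁻¹) ^ n) := by
          refine norm_sum_le_of_le _ fun w _ => ?_
          rw [norm_smul, norm_eb, mul_one, norm_mul, norm_pow, Real.norm_of_nonneg (inv_nonneg.2 ha0.le)]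
          gcongr
          calc _ ≤ ‖p n‖ * ∏ j, ‖EuclideanSpace.single (w j) (1:ℝ)‖ := (p n).le_opNorm _
            _ = ‖p n‖ := by simp
            _ ≤ _ := hb n
      _ = C * ((d:ℝ) * Q * a⁻¹) ^ n := by
          rw [Finset.sum_const, Finset.card_univ, Fintype.card_fun]; simp; ring
      _ = _ := by rw [hdq]
  have hv2 : ∀ n, ‖v n‖ ≤ 2 * C * q * (1/2 : ℝ) ^ n := by
    intro n
    cases n with
    | zero =>
      have : v 0 = 0 := by simp [v, hp0]
      rw [this, norm_zero]; positivity
    | succ n =>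
      calc ‖v (n+1)‖ ≤ C * q ^ (n+1) := hv _
        _ = C * q * q ^ n := by ring
        _ ≤ C * q * (1/2) ^ n := by gcongr
        _ = _ := by ring
  have hg : HasSum (fun n : ℕ => 2 * C * q * (1/2 : ℝ) ^ n) (4 * C * q) := by
    have := hasSum_geometric_two.mul_left (2 * C * q)
    have e : (2 * C * q * 2) = 4 * C * q := by ring
    rwa [e] at this
  have hvs : Summable v := Summable.of_norm_bounded hg.summable hv2
  refine ⟨a, ∑' n, v n, ha0, (tsum_of_norm_bounded hg hv2).trans hq2, ?_, ?_⟩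
  · intro L hL
    have h1 := L.hasSum hvs.hasSum
    refine h1.unique ?_
    convert hasSum_zero using 2 with n
    simp [v, hL]
  · filter_upwards [hp.eventually_hasSum] with x hx L hL
    have h1 := L.hasSum hvs.hasSum
    rw [zero_add] at hx
    have he : ∀ n, L (v n) = p n (fun _ => x) := fun n => by
      rw [cml_expand]
      simp only [v, map_sum, map_smul, hL, dg_cnt, mon_cnt]
      refine Finset.sum_congr rfl fun w _ => ?_
      have : (a⁻¹) ^ n * a ^ n = 1 := by rw [← mul_pow, inv_mul_cancel₀ ha0.ne', one_pow]
      rw [smul_eq_mul]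
      linear_combination (p n (fun j => EuclideanSpace.single (w j) 1) * ∏ j, x (w j)) * this
    simp only [he] at h1
    exact h1.unique hx
end Init
section Final
variable {d : ℕ}

theorem W_pos (a b : ℝ) (ha : 0 < a) (hb : 0 < b) (i : Ix d) : 0 < W a b i := by
  have : (0:ℝ) < bi i := by exact_mod_cast bi_pos i
  unfold W; positivity

theorem lam_pos (hd : 2 ≤ d) (α : Fin d → ℕ) (j : ℕ) : 0 < lam d (α, j+1) := by
  have hdd : (2:ℝ) ≤ d := by exact_mod_cast hd
  simp only [lam]; positivity

theorem fix_exists {A : Type*} [NormedAddCommGroup A] [NormedSpace ℝ A] [CompleteSpace A]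
    (F : A → A) (S K : A →L[ℝ] A) (U0 : A) (R C1 s : ℝ) (hR : 0 < R) (hC1 : 0 ≤ C1)
    (hF : ∀ U V, ‖U‖ ≤ R → ‖V‖ ≤ R → ‖F U - F V‖ ≤ C1 * ‖U - V‖)
    (hU0 : ‖U0‖ ≤ R / 4) (hS : ‖S‖ ≤ s) (hs1 : s * (‖F 0‖ + C1 * R) ≤ R / 4) (hs2 : s * C1 ≤ 1 / 4)
    (hK : ‖K‖ ≤ 1 / 4) : ∃ U, ‖U‖ ≤ R ∧ U = U0 + S (F U) - K U := by
  have hs0 : 0 ≤ s := (norm_nonneg _).trans hS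
  have hSF : ∀ V, ‖S V‖ ≤ s * ‖V‖ := fun V => (S.le_opNorm V).trans (by gcongr)
  have hKF : ∀ V, ‖K V‖ ≤ 1/4 * ‖V‖ := fun V => (K.le_opNorm V).trans (by gcongr)
  let G : A → A := fun U => U0 + S (F U) - K U
  have hmaps : Set.MapsTo G (Metric.closedBall 0 R) (Metric.closedBall 0 R) := by
    intro U hU
    rw [mem_closedBall_zero_iff] at hU ⊢
    have h1 : ‖F U‖ ≤ ‖F 0‖ + C1 * R := by
      have := hF U 0 hU (by simpa using hR.le)
      rw [sub_zero] at this
      have h2 : ‖F U‖ ≤ ‖F 0‖ + ‖F U - F 0‖ := by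
        have := norm_add_le (F 0) (F U - F 0); simpa using this
      have h3 : C1 * ‖U‖ ≤ C1 * R := by gcongr
      linarith
    have h4 : ‖S (F U)‖ ≤ R / 4 := (hSF _).trans (le_trans (by gcongr) hs1)
    have h5 := hKF U
    calc ‖G U‖ ≤ ‖U0‖ + ‖S (F U)‖ + ‖K U‖ := (norm_sub_le _ _).trans (by gcongr; exact norm_add_le _ _)
      _ ≤ R := by linarith
  have hlip : ∀ U V, ‖U‖ ≤ R → ‖V‖ ≤ R → ‖G U - G V‖ ≤ 1/2 * ‖U - V‖ := by
    intro U V hU hV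
    have : G U - G V = S (F U - F V) - K (U - V) := by simp [G]; abel
    rw [this]
    have h1 : ‖S (F U - F V)‖ ≤ 1/4 * ‖U - V‖ := by
      calc ‖S (F U - F V)‖ ≤ s * ‖F U - F V‖ := hSF _
        _ ≤ s * (C1 * ‖U - V‖) := by gcongr; exact hF U V hU hV
        _ = (s * C1) * ‖U - V‖ := by ring
        _ ≤ _ := by gcongr
    have h2 := hKF (U - V)
    have := norm_sub_le (S (F U - F V)) (K (U - V))
    linarith
  have hc : ContractingWith (1/2 : NNReal) (hmaps.restrict G _ _) := by
    refine ⟨by rw [← NNReal.coe_lt_coe]; norm_num, LipschitzWith.of_dist_le_mul fun U V => ?_⟩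
    have := hlip U V (mem_closedBall_zero_iff.1 U.2) (mem_closedBall_zero_iff.1 V.2)
    rw [← dist_eq_norm, ← dist_eq_norm] at this
    simpa [Subtype.dist_eq] using this
  obtain ⟨U, hU1, hU2, -⟩ := hc.exists_fixedPoint' Metric.isClosed_closedBall.isComplete hmaps
    (x := 0) (by simp [hR.le]) (edist_ne_top _ _)
  exact ⟨U, mem_closedBall_zero_iff.1 hU1, hU2.symm⟩

theorem mon_add (α β : Fin d → ℕ) (x : EuclideanSpace ℝ (Fin d)) : mon (α + β) x = mon α x * mon β x := by
  simp [mon, pow_add, Finset.prod_mul_distrib]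

theorem dg_add (α β : Fin d → ℕ) : dg (α + β) = dg α + dg β := by
  simp [dg, Finset.sum_add_distrib]

theorem main_local (hd : 2 ≤ d) (f : ℝ → ℝ) (hf : AnalyticAt ℝ f 0)
    (uL : EuclideanSpace ℝ (Fin d) → ℝ) (h : AnalyticAt ℝ uL 0) (h0 : uL 0 = 0) :
    ∃ u g : EuclideanSpace ℝ (Fin d) → ℝ, AnalyticAt ℝ u 0 ∧ AnalyticAt ℝ g 0 ∧
      ∀ᶠ x in 𝓝 (0 : EuclideanSpace ℝ (Fin d)), lapE u x = f (u x) ∧ u x = uL x + ‖x‖ ^ 2 * g x := by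
  obtain ⟨M, hM1, hM2⟩ := exists_mul d
  obtain ⟨R, F, C1, hR, hC1, hF1, hF2⟩ := exists_F M hM1 (eb (0 : Ix d)) (norm_eb _).le f hf
  obtain ⟨a, U0, ha, hU0, hU1, hU2⟩ := exists_U0 (by omega) uL h h0 (R / 4) (by positivity)
  obtain ⟨b, hb, hb1, hb2, hb3⟩ : ∃ b : ℝ, 0 < b ∧ b⁻¹ * (‖F 0‖ + C1 * R) ≤ R / 4 ∧ b⁻¹ * C1 ≤ 1 / 4 ∧
      d * (a ^ 2 * b⁻¹) ≤ 1 / 4 := by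
    have hp1 : 0 ≤ 4 * (‖F 0‖ + C1 * R) / R := by positivity
    have hp2 : 0 ≤ 4 * C1 := by positivity
    have hp3 : 0 ≤ 4 * (d * a ^ 2) := by positivity
    set b := 1 + 4 * (‖F 0‖ + C1 * R) / R + 4 * C1 + 4 * (d * a ^ 2) with hbdef
    have hb : 0 < b := by positivity
    refine ⟨b, hb, ?_, ?_, ?_⟩
    · rw [inv_mul_le_iff₀ hb]
      have : 4 * (‖F 0‖ + C1 * R) / R ≤ b := by linarith
      rw [div_le_iff₀ hR] at this
      linarith
    · rw [inv_mul_le_iff₀ hb]; linarith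
    · rw [← mul_assoc, mul_inv_le_iff₀ hb]; linarith
  obtain ⟨S, hS1, hS2⟩ := exists_S hd a b ha hb
  obtain ⟨K, hK1, hK2⟩ := exists_K hd a b ha hb
  obtain ⟨U, hUR, hU⟩ := fix_exists F S K U0 R C1 b⁻¹ hR hC1 hF1 hU0 hS1 hb1 hb2 (hK1.trans hb3)
  obtain ⟨Φ, Φ', hΦ, hΦ', hE⟩ := eval_family (d := d) a b ha hb
  obtain ⟨T, hT⟩ := exists_T d
  have hWp := fun i : Ix d => (W_pos a b ha hb i).ne'
  have hlp := fun (α : Fin d → ℕ) j => (lam_pos hd α j).ne'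
  have hbi0 : ∀ α : Fin d → ℕ, bi (α, 0) = 1 := fun α => by simp [bi]
  have hu : AnalyticAt ℝ (fun x => T U (Φ x)) 0 := ((T U).analyticAt _).fun_comp hΦ
  have hg : AnalyticAt ℝ (fun x => T (S (F U) - K U) (Φ' x)) 0 :=
    ((T (S (F U) - K U)).analyticAt _).fun_comp hΦ'
  have key : ∀ᶠ x in 𝓝 (0 : EuclideanSpace ℝ (Fin d)),
      T U (Φ x) = uL x + ‖x‖ ^ 2 * T (S (F U) - K U) (Φ' x) := by
    filter_upwards [hE, hU2] with x ⟨hx1, hx2, _⟩ hx3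
    have e0 : T U0 (Φ x) = uL x := by
      refine hx3 (T.flip (Φ x)) fun α => ?_
      rw [ContinuousLinearMap.flip_apply, hT, hx1]
      simp [W, hbi0]
    have hs : ∀ α j, Φ x (α, j+1) = ‖x‖ ^ 2 * Φ' x (α, j+1) := fun α j => by
      rw [hx1, hx2]; simp; ring
    have eS : (T.flip (Φ x)).comp S = ‖x‖ ^ 2 • (T.flip (Φ' x)).comp S := by
      refine L1_ext fun ⟨α, j⟩ => ?_
      simp [hS2, hT, hs]; ring
    have eK : (T.flip (Φ x)).comp K = ‖x‖ ^ 2 • (T.flip (Φ' x)).comp K := by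
      refine L1_ext fun ⟨α, j⟩ => ?_
      simp only [ContinuousLinearMap.comp_apply, _root_.smul_apply, hK2, map_sum, map_smul,
        ContinuousLinearMap.flip_apply, hT, hs, smul_eq_mul, Finset.mul_sum]
      refine Finset.sum_congr rfl fun k _ => ?_
      ring
    have e1 := DFunLike.congr_fun eS (F U)
    have e2 := DFunLike.congr_fun eK U
    simp only [ContinuousLinearMap.comp_apply, _root_.smul_apply, smul_eq_mul,
      ContinuousLinearMap.flip_apply] at e1 e2
    calc T U (Φ x) = T (U0 + S (F U) - K U) (Φ x) := by rw [← hU]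
      _ = T U0 (Φ x) + T (S (F U)) (Φ x) - T (K U) (Φ x) := by simp
      _ = _ := by rw [e0, e1, e2]; simp; ring
  have hu0 : T U (Φ 0) = 0 := by
    have := key.self_of_nhds
    simpa [h0] using this
  have hut : Tendsto (fun x => T U (Φ x)) (𝓝 0) (𝓝 0) := by
    have := hu.continuousAt.tendsto
    rwa [hu0] at this
  refine ⟨_, _, hu, hg, ?_⟩
  filter_upwards [hE, key, hut.eventually hF2, hΦ.eventually_analyticAt] with x ⟨hx1, hx2, Λ, Ψ, hx3, hx4, hx5⟩ hk hx6 hx7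
  refine ⟨?_, hk⟩
  rw [lapE_clm (T U) Φ x hx7.contDiffAt, hx3, map_add]
  have eS : (T.flip Λ).comp S = T.flip (Φ x) := by
    refine L1_ext fun ⟨α, j⟩ => ?_
    simp only [ContinuousLinearMap.comp_apply, hS2, map_smul,
        ContinuousLinearMap.flip_apply, hT, smul_eq_mul, hx5, hx1, Nat.add_sub_cancel]
    have := hWp (α, j+1)
    have := hlp α j
    field_simp
  have eK : (T.flip Λ).comp K = T.flip Ψ := by
    refine L1_ext fun ⟨α, j⟩ => ?_
    simp only [ContinuousLinearMap.comp_apply, hK2, map_sum, map_smul,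
        ContinuousLinearMap.flip_apply, hT, smul_eq_mul, hx5, hx4, Nat.add_sub_cancel, lapE_mon]
    rw [Finset.sum_mul, Finset.mul_sum]
    refine Finset.sum_congr rfl fun k _ => ?_
    have := hWp (Function.update α k (α k - 2), j+1)
    have := hlp (Function.update α k (α k - 2)) j
    field_simp
  have e0 : T U0 Λ = 0 := by
    refine hU1 (T.flip Λ) fun α => ?_
    rw [ContinuousLinearMap.flip_apply, hT, hx5]
    simp [lam]
  have e1 := DFunLike.congr_fun eS (F U)
  have e2 := DFunLike.congr_fun eK U
  simp only [ContinuousLinearMap.comp_apply, ContinuousLinearMap.flip_apply] at e1 e2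
  have e3 : T U Λ = T (F U) (Φ x) - T U Ψ := by
    calc T U Λ = T (U0 + S (F U) - K U) Λ := by rw [← hU]
      _ = T U0 Λ + T (S (F U)) Λ - T (K U) Λ := by simp
      _ = _ := by rw [e0, e1, e2]; simp
  rw [e3, sub_add_cancel]
  refine hx6 U hUR (T.flip (Φ x)) ?_ ?_ rfl
  · rw [ContinuousLinearMap.flip_apply, hT, hx1]
    simp [W, bi, dg, mon]
  · intro V V'
    let Lx := T.flip (Φ x)
    have hm : (ContinuousLinearMap.compL ℝ (L1 (Ix d)) (L1 (Ix d)) ℝ Lx).comp M =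
        (ContinuousLinearMap.toSpanSingleton ℝ Lx).comp Lx := by
      refine L1_ext fun i => L1_ext fun j => ?_
      simp only [ContinuousLinearMap.comp_apply, ContinuousLinearMap.compL_apply, hM2, Lx, map_smul,
        ContinuousLinearMap.flip_apply, hT, hx1, ContinuousLinearMap.toSpanSingleton_apply,
        _root_.smul_apply, smul_eq_mul, Prod.fst_add, Prod.snd_add, mon_add, W, dg_add]
      have : (bi (i + j) : ℝ) ≠ 0 := by exact_mod_cast (bi_pos (i + j)).ne'
      field_simp
      ring
    have := DFunLike.congr_fun (DFunLike.congr_fun hm V) V'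
    simpa [Lx] using this
end Final

theorem stmt8 (d : ℕ) (hd : 2 ≤ d)
    (f : ℝ → ℝ) (hf : ∃ r : ℝ, 0 < r ∧ AnalyticOnNhd ℝ f (Metric.ball (0 : ℝ) r))
    (hf0 : f 0 = 0)
    (uL : EuclideanSpace ℝ (Fin d) → ℝ)
    (huLbd : ∃ M : ℝ, ∀ x ∈ Metric.ball (0 : EuclideanSpace ℝ (Fin d)) 1, |uL x| ≤ M)
    (huLreg : ContDiffOn ℝ 2 uL (Metric.ball (0 : EuclideanSpace ℝ (Fin d)) 1))
    (huLharm : ∀ x ∈ Metric.ball (0 : EuclideanSpace ℝ (Fin d)) 1, lap d uL x = 0)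
    (huL0 : uL 0 = 0) :
    ∃ r₀ : ℝ, 0 < r₀ ∧ r₀ ≤ 1 ∧
    ∃ u g : EuclideanSpace ℝ (Fin d) → ℝ,
      AnalyticOnNhd ℝ u (Metric.ball (0 : EuclideanSpace ℝ (Fin d)) r₀) ∧
      (∀ x ∈ Metric.ball (0 : EuclideanSpace ℝ (Fin d)) r₀, lap d u x = f (u x)) ∧
      AnalyticOnNhd ℝ g (Metric.ball (0 : EuclideanSpace ℝ (Fin d)) r₀) ∧
      ∀ x ∈ Metric.ball (0 : EuclideanSpace ℝ (Fin d)) r₀,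
        u x = uL x + ‖x‖ ^ 2 * g x := by
  obtain ⟨r, hr, hfr⟩ := hf
  obtain ⟨u, g, hu, hg, hug⟩ := main_local hd f (hfr 0 (Metric.mem_ball_self hr)) uL
    (harm_analytic d hd uL huLreg huLharm) huL0
  have hall := (hu.eventually_analyticAt.and hg.eventually_analyticAt).and hug
  obtain ⟨ε, hε, hb⟩ := Metric.eventually_nhds_iff_ball.1 hall
  have hsub : ∀ x ∈ Metric.ball (0 : EuclideanSpace ℝ (Fin d)) (min ε 1),
      x ∈ Metric.ball (0 : EuclideanSpace ℝ (Fin d)) ε :=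
    fun x hx => Metric.ball_subset_ball (min_le_left _ _) hx
  refine ⟨min ε 1, lt_min hε one_pos, min_le_right _ _, u, g, fun x hx => (hb x (hsub x hx)).1.1, fun x hx => ?_,
    fun x hx => (hb x (hsub x hx)).1.2, fun x hx => (hb x (hsub x hx)).2.2⟩
  rw [lap_eq_lapE]
  exact (hb x (hsub x hx)).2.1
end

section
/- Let d ≥ 3, let q be a positive integer with q > d/(d−2), let κ ∈ ℝ and C > 0. Let u : ℝ^d → ℝ be twice continuously differentiable on the region {x : ‖x‖ ≥ 1}, satisfy Δu(x) = κ u(x)^q for all ‖x‖ ≥ 1, and satisfy the decay bound |u(x)| ≤ C ‖x‖^{−(d−2)} for all ‖x‖ ≥ 1. Then there exist C' > 0 and R ≥ 2 such that |∇u(x)| ≤ C' ‖x‖^{−d+1} for all ‖x‖ ≥ R; in particular ∫_{‖x‖≥R} |∇u(x)|² dx < ∞. -/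
open MeasureTheory

lemma aux_second (f f' : ℝ → ℝ) (c : ℝ) (h1 : ∀ᶠ t in nhds (0:ℝ), HasDerivAt f (f' t) t)
    (h2 : HasDerivAt f' c 0) (hm : IsLocalMax f 0) : c ≤ 0 := by
  by_contra hc
  push Not at hc
  have e1 : deriv f =ᶠ[nhds 0] f' := h1.mono fun t ht => ht.deriv
  have e2 : deriv (deriv f) 0 = c := by rw [e1.deriv_eq, h2.deriv]
  have hmin : IsLocalMin f 0 :=
    isLocalMin_of_deriv_deriv_pos (by rw [e2]; exact hc) hm.deriv_eq_zero h1.self_of_nhds.continuousAt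
  have e3 : f =ᶠ[nhds 0] fun _ => f 0 := by
    filter_upwards [hm, hmin] with t ht1 ht2
    exact le_antisymm ht1 ht2
  have e4 : deriv f =ᶠ[nhds 0] deriv (fun _ : ℝ => f 0) := e3.deriv
  have e5 := e4.deriv_eq
  rw [e2] at e5
  simp at e5
  linarith

lemma aux_line {E : Type*} [NormedAddCommGroup E] [NormedSpace ℝ E] (u : E → ℝ) (p e : E) (a : ℝ)
    (hu : ContDiffAt ℝ 2 u p) :
    (∀ᶠ t in nhds (0:ℝ), HasDerivAt (fun s : ℝ => u (p + (s * a) • e))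
      (a * fderiv ℝ u (p + (t * a) • e) e) t) ∧
    HasDerivAt (fun t : ℝ => a * fderiv ℝ u (p + (t * a) • e) e)
      (a ^ 2 * fderiv ℝ (fun y => fderiv ℝ u y e) p e) 0 := by
  have hl : ∀ t : ℝ, HasDerivAt (fun s : ℝ => p + (s * a) • e) (a • e) t := by
    intro t
    have := (((hasDerivAt_id t).mul_const a).smul_const e).const_add p
    simpa using this
  have hev : ∀ᶠ y in nhds p, ContDiffAt ℝ 2 u y := hu.eventually (by simp)
  have ht0 : Filter.Tendsto (fun s : ℝ => p + (s * a) • e) (nhds 0) (nhds p) := by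
    have := (hl 0).continuousAt.tendsto
    simpa using this
  constructor
  · filter_upwards [ht0.eventually hev] with t ht
    have h := (ht.differentiableAt (by norm_num)).hasFDerivAt.comp_hasDerivAt t (hl t)
    simpa [Function.comp_def] using h
  · have hd : DifferentiableAt ℝ (fderiv ℝ u) p :=
      (hu.fderiv_right (m := 1) (by norm_num)).differentiableAt (by norm_num)
    have hd2 : DifferentiableAt ℝ (fun y => fderiv ℝ u y e) p :=
      hd.clm_apply (differentiableAt_const e)
    have hp : p + ((0:ℝ) * a) • e = p := by simp
    have h := HasFDerivAt.comp_hasDerivAt (0:ℝ) (f := fun s : ℝ => p + (s * a) • e)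
      (by rw [hp]; exact hd2.hasFDerivAt) (hl 0)
    have h' := h.const_mul a
    refine h'.congr_deriv ?_
    simp
    ring

lemma aux_pos {d : ℕ} (hd : 1 ≤ d) (u : EuclideanSpace ℝ (Fin d) → ℝ)
    (x : EuclideanSpace ℝ (Fin d)) (r M N : ℝ) (hr : 0 < r) (hM : 0 ≤ M) (hN : 0 ≤ N)
    (hu : ∀ y, ‖y‖ ≤ r → ContDiffAt ℝ 2 u (x + y))
    (hb : ∀ y, ‖y‖ ≤ r → |u (x + y)| ≤ M)
    (hl : ∀ y, ‖y‖ ≤ r → |lap d u (x + y)| < N) (i : Fin d) :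
    fderiv ℝ u x (EuclideanSpace.single i 1) ≤ d * M / r + N * r / 2 := by
  have hd' : (1:ℝ) ≤ d := by exact_mod_cast hd
  set e : Fin d → EuclideanSpace ℝ (Fin d) := fun j => EuclideanSpace.single j 1 with he
  have hei : ∀ j k, (e j) k = if k = j then 1 else 0 := by
    intro j k; simp [he]
  -- reflection
  let S : EuclideanSpace ℝ (Fin d) → EuclideanSpace ℝ (Fin d) := fun y => y - (2 * y i) • e i
  have hS : ∀ y, ‖S y‖ = ‖y‖ := by
    intro y
    rw [EuclideanSpace.norm_eq, EuclideanSpace.norm_eq]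
    congr 1
    apply Finset.sum_congr rfl
    intro k _
    by_cases hk : k = i
    · subst hk
      simp only [S, PiLp.sub_apply, PiLp.smul_apply, hei, Real.norm_eq_abs, sq_abs]
      simp
      ring
    · simp [S, hei, hk]
  have hScont : Continuous S := by
    have : Continuous fun y : EuclideanSpace ℝ (Fin d) => y i := by fun_prop
    fun_prop
  let s : Fin d → ℝ := fun j => if j = i then -1 else 1
  have hs : ∀ j, s j ^ 2 = 1 := by intro j; simp only [s]; split_ifs <;> norm_num
  have hSl : ∀ y j (t : ℝ), S (y + t • e j) = S y + (t * s j) • e j := by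
    intro y j t
    ext k
    simp only [S, s, PiLp.add_apply, PiLp.sub_apply, PiLp.smul_apply, hei, smul_eq_mul]
    by_cases hj : j = i
    · subst hj
      by_cases hk : k = j
      · simp [hk]; ring
      · simp [hk]
    · have : i ≠ j := fun h => hj h.symm
      simp [hj, this]; ring
  let ψ : EuclideanSpace ℝ (Fin d) → ℝ := fun y =>
    (M / r ^ 2) * (‖y‖ ^ 2 + d * (y i * (r - y i))) + N / 2 * (y i * (r - y i))
  have hψl : ∀ y j, ∃ c0 c1 : ℝ, ∀ t : ℝ, ψ (y + t • e j) = c0 + c1 * t +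
      ((M / r ^ 2) * (1 - if j = i then (d:ℝ) else 0) - if j = i then N / 2 else 0) * t ^ 2 := by
    intro y j
    have hn : ∀ t : ℝ, ‖y + t • e j‖ ^ 2 = ‖y‖ ^ 2 + 2 * (t * y j) + t ^ 2 := by
      intro t
      rw [norm_add_sq_real, norm_smul]
      simp [he, inner_smul_right, EuclideanSpace.inner_single_right]
    by_cases hj : j = i
    · subst hj
      refine ⟨ψ y, (M / r ^ 2) * (2 * y j + d * (r - 2 * y j)) + N / 2 * (r - 2 * y j), ?_⟩
      intro t
      simp only [ψ, hn, PiLp.add_apply, PiLp.smul_apply, hei, smul_eq_mul]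
      simp
      ring
    · have : i ≠ j := fun h => hj h.symm
      refine ⟨ψ y, (M / r ^ 2) * (2 * y j), ?_⟩
      intro t
      simp only [ψ, hn, PiLp.add_apply, PiLp.smul_apply, hei, smul_eq_mul]
      simp [hj, this]
      ring
  let w : EuclideanSpace ℝ (Fin d) → ℝ := fun y => (u (x + y) - u (x + S y)) / 2 - ψ y
  let K : Set (EuclideanSpace ℝ (Fin d)) := Metric.closedBall 0 r ∩ {y | 0 ≤ y i}
  have hKc : IsCompact K := by
    apply (isCompact_closedBall _ _).inter_right
    exact isClosed_le continuous_const (by fun_prop)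
  have hmemK : ∀ y, y ∈ K ↔ ‖y‖ ≤ r ∧ 0 ≤ y i := by intro y; simp [K]
  have hψc : Continuous ψ := by
    have : Continuous fun y : EuclideanSpace ℝ (Fin d) => y i := by fun_prop
    fun_prop
  have hwc : ContinuousOn w K := by
    intro y hy
    have hy' := ((hmemK y).1 hy).1
    have h1 : ContinuousAt (fun y => u (x + y)) y :=
      ContinuousAt.comp (f := fun y => x + y) (g := u) (hu y hy').continuousAt (by fun_prop)
    have h2 : ContinuousAt (fun y => u (x + S y)) y :=
      ContinuousAt.comp (f := fun y => x + S y) (g := u)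
        (hu (S y) (by rw [hS]; exact hy')).continuousAt (by fun_prop)
    exact (((h1.sub h2).div_const 2).sub hψc.continuousAt).continuousWithinAt
  have hyi : ∀ y : EuclideanSpace ℝ (Fin d), ‖y‖ ≤ r → y i ≤ r := fun y hy =>
    (le_abs_self _).trans ((PiLp.norm_apply_le y i).trans hy)
  have hwK : ∀ y ∈ K, w y ≤ 0 := by
    obtain ⟨y0, hy0, hmax⟩ := hKc.exists_isMaxOn (f := w) ⟨0, by simp [hmemK, hr.le]⟩ hwc
    by_contra hcon
    push Not at hcon
    obtain ⟨y1, hy1, hw1⟩ := hcon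
    have hw0 : 0 < w y0 := lt_of_lt_of_le hw1 (hmax hy1)
    obtain ⟨hn0, hi0⟩ := (hmemK y0).1 hy0
    have hMr : 0 ≤ M / r ^ 2 := by positivity
    have hprod : 0 ≤ y0 i * (r - y0 i) := mul_nonneg hi0 (by linarith [hyi y0 hn0])
    have hipos : 0 < y0 i := by
      rcases hi0.lt_or_eq with h | h
      · exact h
      · exfalso
        have : S y0 = y0 := by simp [S, ← h]
        simp only [w, this, ψ, ← h] at hw0
        have : 0 ≤ M / r ^ 2 * ‖y0‖ ^ 2 := by positivity
        simp at hw0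
        linarith
    have hnlt : ‖y0‖ < r := by
      rcases hn0.lt_or_eq with h | h
      · exact h
      · exfalso
        have h1 := (abs_le.1 (hb y0 hn0)).2
        have h2 := (abs_le.1 (hb (S y0) (by rw [hS]; exact hn0))).1
        have h3 : M ≤ ψ y0 := by
          simp only [ψ, h]
          have : M / r ^ 2 * (r ^ 2 + d * (y0 i * (r - y0 i))) =
            M + M / r ^ 2 * (d * (y0 i * (r - y0 i))) := by field_simp
          rw [this]
          have : 0 ≤ M / r ^ 2 * (d * (y0 i * (r - y0 i))) := by positivity
          have : 0 ≤ N / 2 * (y0 i * (r - y0 i)) := by positivity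
          linarith
        simp only [w] at hw0
        linarith
    have hnb : K ∈ nhds y0 := by
      have h1 : ∀ᶠ y in nhds y0, ‖y‖ < r := continuous_norm.continuousAt.eventually_lt_const hnlt
      have h2 : ∀ᶠ y : EuclideanSpace ℝ (Fin d) in nhds y0, 0 < y i :=
        Filter.Tendsto.eventually_const_lt hipos (Continuous.tendsto (by fun_prop) y0)
      filter_upwards [h1, h2] with y a b
      exact (hmemK y).2 ⟨a.le, b.le⟩
    have hloc : IsLocalMax w y0 := hmax.isLocalMax hnb
    have key : ∀ j, (fderiv ℝ (fun y => fderiv ℝ u y (e j)) (x + y0) (e j)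
        - fderiv ℝ (fun y => fderiv ℝ u y (e j)) (x + S y0) (e j)) / 2
        - 2 * ((M / r ^ 2) * (1 - if j = i then (d:ℝ) else 0) - if j = i then N / 2 else 0) ≤ 0 := by
      intro j
      obtain ⟨c0, c1, hc⟩ := hψl y0 j
      generalize ((M / r ^ 2) * (1 - if j = i then (d:ℝ) else 0)
        - if j = i then N / 2 else 0) = c2 at hc ⊢
      obtain ⟨a1, a2⟩ := aux_line u (x + y0) (e j) 1 (hu y0 hn0)
      obtain ⟨b1, b2⟩ := aux_line u (x + S y0) (e j) (s j) (hu (S y0) (by rw [hS]; exact hn0))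
      have hf : (fun t : ℝ => w (y0 + t • e j)) = fun t : ℝ =>
        (u (x + y0 + (t * 1) • e j) - u (x + S y0 + (t * s j) • e j)) / 2
          - (c0 + c1 * t + c2 * t ^ 2) := by
        funext t
        simp only [w, hc, hSl, mul_one, add_assoc]
      have hlm : IsLocalMax (fun t : ℝ => w (y0 + t • e j)) 0 := by
        have ht : Filter.Tendsto (fun t : ℝ => y0 + t • e j) (nhds 0) (nhds y0) := by
          have : Continuous (fun t : ℝ => y0 + t • e j) := by fun_prop
          simpa using this.tendsto 0
        have := ht.eventually hloc
        filter_upwards [this] with t ht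
        simpa using ht
      rw [hf] at hlm
      refine aux_second _ (fun t => (1 * fderiv ℝ u (x + y0 + (t * 1) • e j) (e j) -
        s j * fderiv ℝ u (x + S y0 + (t * s j) • e j) (e j)) / 2 - (c1 + 2 * c2 * t)) _ ?_ ?_ hlm
      · filter_upwards [a1, b1] with t ht1 ht2
        have hp : HasDerivAt (fun t : ℝ => c0 + c1 * t + c2 * t ^ 2) (c1 + 2 * c2 * t) t := by
          have := (((hasDerivAt_id t).const_mul c1).const_add c0).add
            (((hasDerivAt_id t).pow 2).const_mul c2)
          refine this.congr_deriv ?_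
          simp; ring
        exact ((ht1.sub ht2).div_const 2).sub hp
      · have hp : HasDerivAt (fun t : ℝ => c1 + 2 * c2 * t) (2 * c2) 0 := by
          have := ((hasDerivAt_id (0:ℝ)).const_mul (2 * c2)).const_add c1
          simpa using this
        have := ((a2.sub b2).div_const 2).sub hp
        rw [hs j, one_pow, one_mul, one_mul] at this
        exact this
    have hsum := Finset.sum_nonpos (s := Finset.univ) (fun j _ => key j)
    have h1 := (abs_lt.1 (hl y0 hn0)).1
    have h2 := (abs_lt.1 (hl (S y0) (by rw [hS]; exact hn0))).2
    rw [Finset.sum_sub_distrib, ← Finset.sum_div, Finset.sum_sub_distrib, ← Finset.mul_sum,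
      Finset.sum_sub_distrib, ← Finset.mul_sum, Finset.sum_sub_distrib] at hsum
    simp at hsum
    simp only [lap] at h1 h2
    simp only [he] at hsum
    linarith
  -- derivative at zero
  set B := d * M / r + N * r / 2 with hB
  have hux := hu 0 (by simpa using hr.le)
  simp only [add_zero] at hux
  have hline : ∀ a : ℝ, HasDerivAt (fun t : ℝ => u (x + (t * a) • e i)) (a * fderiv ℝ u x (e i)) 0 := by
    intro a
    have := (aux_line u x (e i) a hux).1.self_of_nhds
    simpa using this
  have hg : HasDerivAt (fun t : ℝ => (u (x + (t * 1) • e i) - u (x + (t * (-1)) • e i)) / 2)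
      (fderiv ℝ u x (e i)) 0 := by
    refine (((hline 1).sub (hline (-1))).div_const 2).congr_deriv ?_
    ring
  have hle : ∀ t : ℝ, 0 < t → t ≤ r →
      (u (x + (t * 1) • e i) - u (x + (t * (-1)) • e i)) / 2 ≤ t * B := by
    intro t ht htr
    have hne : ‖t • e i‖ = t := by rw [norm_smul]; simp [he, abs_of_pos ht]
    have h1 := hwK (t • e i) ((hmemK _).2 ⟨by rw [hne]; exact htr, by simp [hei, ht.le]⟩)
    have hSt : S (t • e i) = (t * (-1)) • e i := by
      have := hSl 0 i t
      simpa [S, s] using this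
    have h2 : ψ (t • e i) ≤ t * B := by
      simp only [ψ, hne, PiLp.smul_apply, hei, if_true, smul_eq_mul, mul_one]
      have e1 : t * B - (M / r ^ 2 * (t ^ 2 + ↑d * (t * (r - t))) + N / 2 * (t * (r - t)))
        = M / r ^ 2 * ((d - 1) * t ^ 2) + N / 2 * t ^ 2 := by
        rw [hB]; field_simp; ring
      have : 0 ≤ M / r ^ 2 * ((d - 1) * t ^ 2) := by
        have : (0:ℝ) ≤ d - 1 := by linarith
        positivity
      have : 0 ≤ N / 2 * t ^ 2 := by positivity
      linarith
    simp only [w, hSt] at h1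
    rw [mul_one]
    linarith
  have hsl := hg.tendsto_slope_zero_right
  refine le_of_tendsto hsl ?_
  have : ∀ᶠ t in nhdsWithin (0:ℝ) (Set.Ioi 0), t ∈ Set.Ioc 0 r := Ioc_mem_nhdsGT hr
  filter_upwards [this] with t ht
  have := hle t ht.1 ht.2
  simp only [zero_add, zero_mul, zero_smul, add_zero, sub_self, zero_div, sub_zero, smul_eq_mul]
  rw [inv_mul_le_iff₀ ht.1]
  exact this

lemma aux_abs {d : ℕ} (hd : 1 ≤ d) (u : EuclideanSpace ℝ (Fin d) → ℝ)
    (x : EuclideanSpace ℝ (Fin d)) (r M N : ℝ) (hr : 0 < r) (hM : 0 ≤ M) (hN : 0 ≤ N)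
    (hu : ∀ y, ‖y‖ ≤ r → ContDiffAt ℝ 2 u (x + y))
    (hb : ∀ y, ‖y‖ ≤ r → |u (x + y)| ≤ M)
    (hl : ∀ y, ‖y‖ ≤ r → |lap d u (x + y)| < N) (i : Fin d) :
    |fderiv ℝ u x (EuclideanSpace.single i 1)| ≤ d * M / r + N * r / 2 := by
  rw [abs_le']
  refine ⟨aux_pos hd u x r M N hr hM hN hu hb hl i, ?_⟩
  have hneg : ∀ y, fderiv ℝ (fun z => - u z) y = - fderiv ℝ u y := fun y => fderiv_fun_neg
  have := aux_pos hd (fun z => - u z) x r M N hr hM hN (fun y hy => (hu y hy).neg)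
    (fun y hy => by rw [abs_neg]; exact hb y hy) (fun y hy => by
      have : lap d (fun z => - u z) (x + y) = - lap d u (x + y) := by
        simp [lap, hneg, fderiv_fun_neg]
      rw [this, abs_neg]; exact hl y hy) i
  simpa [hneg] using this

lemma aux_norm {d : ℕ} (L : EuclideanSpace ℝ (Fin d) →L[ℝ] ℝ) (B : ℝ) (hB : 0 ≤ B)
    (h : ∀ i, |L (EuclideanSpace.single i 1)| ≤ B) : ‖L‖ ≤ d * B := by
  refine L.opNorm_le_bound (by positivity) ?_
  intro y
  have hy : y = ∑ i, y i • EuclideanSpace.single i (1:ℝ) := by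
    ext k
    simp [Finset.sum_apply, Pi.single_apply]
  conv_lhs => rw [hy]
  rw [map_sum]
  calc ‖∑ i, L (y i • EuclideanSpace.single i (1:ℝ))‖
      ≤ ∑ i, ‖L (y i • EuclideanSpace.single i (1:ℝ))‖ := norm_sum_le _ _
    _ ≤ ∑ i : Fin d, B * ‖y‖ := by
        apply Finset.sum_le_sum
        intro i _
        rw [map_smul, norm_smul, mul_comm]
        exact mul_le_mul (h i) (PiLp.norm_apply_le y i) (norm_nonneg _) hB
    _ = d * B * ‖y‖ := by simp; ring

theorem stmt11 (d : ℕ) (hd : 3 ≤ d) (q : ℕ) (hq : 0 < q)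
    (hsup : (d : ℝ) / ((d : ℝ) - 2) < (q : ℝ)) (κ : ℝ) (C : ℝ) (hC : 0 < C)
    (u : EuclideanSpace ℝ (Fin d) → ℝ)
    (hreg : ContDiffOn ℝ 2 u {x : EuclideanSpace ℝ (Fin d) | 1 ≤ ‖x‖})
    (heq : ∀ x : EuclideanSpace ℝ (Fin d), 1 ≤ ‖x‖ → lap d u x = κ * u x ^ q)
    (hdecay : ∀ x : EuclideanSpace ℝ (Fin d), 1 ≤ ‖x‖ →
      |u x| ≤ C * ‖x‖ ^ ((2 : ℝ) - (d : ℝ))) :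
    ∃ C' : ℝ, 0 < C' ∧ ∃ R : ℝ, 2 ≤ R ∧
      (∀ x : EuclideanSpace ℝ (Fin d), R ≤ ‖x‖ →
        ‖fderiv ℝ u x‖ ≤ C' * ‖x‖ ^ ((1 : ℝ) - (d : ℝ))) ∧
      IntegrableOn (fun x => ‖fderiv ℝ u x‖ ^ 2)
        {x : EuclideanSpace ℝ (Fin d) | R ≤ ‖x‖} volume := by
  have hd3 : (3:ℝ) ≤ d := by exact_mod_cast hd
  have hdq : ((2:ℝ) - d) * q ≤ -d := by
    rw [div_lt_iff₀ (by linarith)] at hsup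
    linarith
  set A : ℝ := d * C + (|κ| + 1) * C ^ q / 2 with hA
  have hApos : 0 < A := by positivity
  set C' : ℝ := d * (A * (1 / 2 : ℝ) ^ ((1:ℝ) - d)) with hC'
  have hC'pos : 0 < C' := by positivity
  have hbound : ∀ x : EuclideanSpace ℝ (Fin d), 4 ≤ ‖x‖ →
        ‖fderiv ℝ u x‖ ≤ C' * ‖x‖ ^ ((1 : ℝ) - (d : ℝ)) := by
    intro x hx
    set r := ‖x‖ / 2 with hr
    have hr2 : 2 ≤ r := by linarith
    have hr0 : 0 < r := by linarith
    have hfar : ∀ y, ‖y‖ ≤ r → r ≤ ‖x + y‖ := by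
      intro y hy
      have := norm_sub_le (x + y) y
      simp at this
      linarith
    set M := C * r ^ ((2:ℝ) - d) with hM
    have hMpos : 0 < M := by positivity
    have hb : ∀ y, ‖y‖ ≤ r → |u (x + y)| ≤ M := by
      intro y hy
      have h1 := hfar y hy
      refine (hdecay _ (by linarith)).trans ?_
      refine mul_le_mul_of_nonneg_left ?_ hC.le
      exact Real.rpow_le_rpow_of_nonpos hr0 h1 (by linarith)
    have hD := aux_abs (by omega) u x r M ((|κ| + 1) * M ^ q) hr0 hMpos.le (by positivity)
      (fun y hy => by
        have h1 := hfar y hy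
        refine hreg.contDiffAt ?_
        have h2 : ∀ᶠ z in nhds (x + y), 1 < ‖z‖ :=
          continuous_norm.continuousAt.eventually_const_lt (by linarith)
        filter_upwards [h2] with z hz using hz.le) hb
      (fun y hy => by
        have h1 := hfar y hy
        rw [heq _ (by linarith), abs_mul, abs_pow]
        have h2 : |u (x + y)| ^ q ≤ M ^ q := pow_le_pow_left₀ (abs_nonneg _) (hb y hy) q
        have h3 : 0 < M ^ q := by positivity
        nlinarith [abs_nonneg κ, mul_le_mul_of_nonneg_left h2 (abs_nonneg κ)])
    have hle : d * M / r + (|κ| + 1) * M ^ q * r / 2 ≤ A * r ^ ((1:ℝ) - d) := by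
      have e1 : M / r = C * r ^ ((1:ℝ) - d) := by
        rw [hM, mul_div_assoc, ← Real.rpow_sub_one hr0.ne']
        congr 2; ring
      have e2 : M ^ q * r ≤ C ^ q * r ^ ((1:ℝ) - d) := by
        rw [hM, mul_pow, ← Real.rpow_mul_natCast hr0.le, mul_assoc, ← Real.rpow_add_one hr0.ne']
        refine mul_le_mul_of_nonneg_left ?_ (by positivity)
        exact Real.rpow_le_rpow_of_exponent_le (by linarith) (by linarith)
      have e3 : (|κ| + 1) * (M ^ q * r) ≤ (|κ| + 1) * (C ^ q * r ^ ((1:ℝ) - d)) :=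
        mul_le_mul_of_nonneg_left e2 (by positivity)
      have e4 : d * M / r = d * (C * r ^ ((1:ℝ) - d)) := by rw [← e1]; ring
      rw [e4, hA]
      linarith
    have hfin := aux_norm (fderiv ℝ u x) (A * r ^ ((1:ℝ) - d)) (by positivity)
      (fun i => (hD i).trans hle)
    refine hfin.trans (le_of_eq ?_)
    have : r = 1 / 2 * ‖x‖ := by rw [hr]; ring
    rw [this, Real.mul_rpow (by norm_num) (norm_nonneg _), hC']
    ring
  refine ⟨C', hC'pos, 4, by norm_num, hbound, ?_⟩
  have hint : Integrable (fun x : EuclideanSpace ℝ (Fin d) =>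
      C' ^ 2 * (1 / 2 : ℝ) ^ (2 * ((1:ℝ) - d)) * (1 + ‖x‖) ^ (-(2 * (d:ℝ) - 2))) volume := by
    refine (integrable_one_add_norm (μ := volume) ?_).const_mul _
    simp
    linarith
  refine Integrable.mono' hint.integrableOn ?_ ?_
  · exact ((measurable_fderiv ℝ u).norm.pow_const 2).aestronglyMeasurable
  · refine (ae_restrict_iff' (measurableSet_le measurable_const measurable_norm)).2 ?_
    refine Filter.Eventually.of_forall ?_
    intro x hx
    have hx4 : 4 ≤ ‖x‖ := hx
    have hx0 : 0 < ‖x‖ := by linarith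
    rw [Real.norm_of_nonneg (by positivity)]
    have h1 := pow_le_pow_left₀ (norm_nonneg _) (hbound x hx4) 2
    refine h1.trans ?_
    rw [mul_pow, mul_assoc]
    refine mul_le_mul_of_nonneg_left ?_ (by positivity)
    have e : -(2 * (d:ℝ) - 2) = 2 * (1 - d) := by ring
    rw [e, ← Real.mul_rpow (by norm_num) (by positivity), ← Real.rpow_mul_natCast hx0.le]
    have e' : (1 - (d:ℝ)) * ((2:ℕ):ℝ) = 2 * (1 - d) := by push_cast; ring
    rw [e']
    exact Real.rpow_le_rpow_of_nonpos (by positivity) (by linarith) (by linarith)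
end

section
/- Let d ≥ 3, set 2* = 2d/(d−2), q = (d+2)/(d−2) and p = 2d²/(d−2)². There exist ε₀ > 0 and C > 0, depending only on d, such that the following holds for every κ ∈ ℝ with |κ| ≤ 1. Let u : ℝ^d → ℝ be continuously differentiable on Ω = {x : ‖x‖ ≥ 1/2}, with ∫_Ω |∇u|² dx < ∞ and ∫_Ω |u|^{2*} dx < ∞, and assume the weak formulation: for every smooth compactly supported φ : ℝ^d → ℝ with support contained in {x : ‖x‖ > 1/2}, ∫_Ω ∇u·∇φ dx + κ ∫_Ω |u|^{q−1} u φ dx = 0. If ε := (∫_Ω |u|^{2*} dx)^{1/2*} ≤ ε₀, then (∫_{3/4 < ‖x‖ < 3/2} |u|^p dx)^{1/p} ≤ C ε. -/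
open MeasureTheory

/-- The pointwise scalar product `∇u(x)·∇φ(x)` of the gradients of two real-valued functions
on `ℝ^d`. -/
noncomputable def gradDot (d : ℕ) (u φ : EuclideanSpace ℝ (Fin d) → ℝ)
    (x : EuclideanSpace ℝ (Fin d)) : ℝ :=
  ∑ a : Fin d, fderiv ℝ u x (EuclideanSpace.single a 1) * fderiv ℝ φ x (EuclideanSpace.single a 1)

/-- The squared Euclidean norm `|∇u(x)|²` of the gradient of a real-valued function on `ℝ^d`. -/
noncomputable def gradNormSq (d : ℕ) (u : EuclideanSpace ℝ (Fin d) → ℝ)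
    (x : EuclideanSpace ℝ (Fin d)) : ℝ :=
  ∑ a : Fin d, fderiv ℝ u x (EuclideanSpace.single a 1) ^ 2

/-- Smooth approximation of a compactly supported `C^1` function in `C^1` norm. -/
lemma aux_mollify {d : ℕ} {φ : EuclideanSpace ℝ (Fin d) → ℝ} (hφ : ContDiff ℝ 1 φ)
    (hc : HasCompactSupport φ) {W : Set (EuclideanSpace ℝ (Fin d))} (hW : IsOpen W)
    (hs : tsupport φ ⊆ W) {ε : ℝ} (hε : 0 < ε) :
    ∃ ψ : EuclideanSpace ℝ (Fin d) → ℝ, (∀ n : ℕ, ContDiff ℝ n ψ) ∧ HasCompactSupport ψ ∧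
      tsupport ψ ⊆ W ∧ (∀ x, |ψ x - φ x| ≤ ε) ∧ ∀ x, ‖fderiv ℝ ψ x - fderiv ℝ φ x‖ ≤ ε := by
  obtain ⟨δ₀, hδ₀, hsub⟩ := (show IsCompact (tsupport φ) from hc).exists_cthickening_subset_open hW hs
  have hcd : Continuous (fderiv ℝ φ) := hφ.continuous_fderiv one_ne_zero
  have hu1 : UniformContinuous φ := hφ.continuous.uniformContinuous_of_tendsto_cocompact hc.is_zero_at_infty
  have hu2 : UniformContinuous (fderiv ℝ φ) :=
    hcd.uniformContinuous_of_tendsto_cocompact (hc.fderiv ℝ).is_zero_at_infty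
  obtain ⟨δ₁, hδ₁, h1⟩ := Metric.uniformContinuous_iff.1 hu1 ε hε
  obtain ⟨δ₂, hδ₂, h2⟩ := Metric.uniformContinuous_iff.1 hu2 ε hε
  set δ := min δ₀ (min δ₁ δ₂) with hδdef
  have hδ : 0 < δ := by positivity
  let b : ContDiffBump (0 : EuclideanSpace ℝ (Fin d)) := ⟨δ / 2, δ, by positivity, by linarith⟩
  have hbr : b.rOut = δ := rfl
  set ψ : EuclideanSpace ℝ (Fin d) → ℝ :=
    convolution (b.normed volume) φ (ContinuousLinearMap.lsmul ℝ ℝ) volume with hψ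
  have hli : LocallyIntegrable (b.normed volume) volume := b.integrable_normed.locallyIntegrable
  have hder : ∀ x, HasFDerivAt ψ
      (convolution (b.normed volume) (fderiv ℝ φ) (ContinuousLinearMap.lsmul ℝ ℝ) volume x) x := by
    intro x
    have := hc.hasFDerivAt_convolution_right (ContinuousLinearMap.lsmul ℝ ℝ) hli hφ x
    exact this
  have hsupp : tsupport ψ ⊆ Metric.cthickening δ (tsupport φ) := by
    refine closure_minimal ?_ Metric.isClosed_cthickening
    intro x hx
    by_contra hxn
    apply hx
    have hz : ∀ y ∈ Metric.ball x δ, φ y = 0 := by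
      intro y hy
      by_contra hne
      apply hxn
      refine Metric.mem_cthickening_of_dist_le x y δ _ (subset_tsupport φ hne) ?_
      rw [Metric.mem_ball, dist_comm] at hy
      exact hy.le
    have hx0 := hz x (Metric.mem_ball_self hδ)
    rw [hψ, b.normed_convolution_eq_right (fun y hy => by rw [hz y hy, hx0]), hx0]
  refine ⟨ψ, ?_, ?_, ?_, ?_, ?_⟩
  · intro n
    exact b.hasCompactSupport_normed.contDiff_convolution_left _ (b.contDiff_normed (n := n))
      (hφ.continuous.integrable_of_hasCompactSupport hc).locallyIntegrable
  · exact HasCompactSupport.of_support_subset_isCompact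
      (show IsCompact (tsupport φ) from hc).cthickening ((subset_tsupport ψ).trans hsupp)
  · exact hsupp.trans ((Metric.cthickening_mono (min_le_left _ _) _).trans hsub)
  · intro x
    have := b.dist_normed_convolution_le (μ := volume) (g := φ) (x₀ := x) (ε := ε)
      hφ.continuous.aestronglyMeasurable (fun y hy => (h1 (lt_of_lt_of_le hy
        ((min_le_right _ _).trans (min_le_left _ _)))).le)
    simpa [Real.dist_eq] using this
  · intro x
    have := b.dist_normed_convolution_le (μ := volume) (g := fderiv ℝ φ) (x₀ := x) (ε := ε)
      hcd.aestronglyMeasurable (fun y hy => (h2 (lt_of_lt_of_le hy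
        ((min_le_right _ _).trans (min_le_right _ _)))).le)
    rw [(hder x).fderiv, ← dist_eq_norm]
    exact this

/-- Extension of the weak formulation to `C^1` test functions. -/
lemma aux_weak_ext {d : ℕ} {v g : EuclideanSpace ℝ (Fin d) → ℝ} (hv : ContDiff ℝ 1 v)
    (hvc : HasCompactSupport v) (hg : Continuous g) (hgc : HasCompactSupport g)
    {W : Set (EuclideanSpace ℝ (Fin d))} (hW : IsOpen W)
    (h : ∀ φ : EuclideanSpace ℝ (Fin d) → ℝ, (∀ n : ℕ, ContDiff ℝ n φ) → HasCompactSupport φ →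
      tsupport φ ⊆ W → (∫ x, gradDot d v φ x) + ∫ x, g x * φ x = 0)
    {φ : EuclideanSpace ℝ (Fin d) → ℝ} (hφ : ContDiff ℝ 1 φ)
    (hc : HasCompactSupport φ) (hs : tsupport φ ⊆ W) :
    (∫ x, gradDot d v φ x) + ∫ x, g x * φ x = 0 := by
  have hvd : ∀ a : Fin d, Continuous fun x => fderiv ℝ v x (EuclideanSpace.single a 1) :=
    fun a => (hv.continuous_fderiv one_ne_zero).clm_apply continuous_const
  have hvdc : ∀ a : Fin d, HasCompactSupport fun x => fderiv ℝ v x (EuclideanSpace.single a 1) :=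
    fun a => (hvc.fderiv ℝ).comp_left (g := fun L : EuclideanSpace ℝ (Fin d) →L[ℝ] ℝ =>
      L (EuclideanSpace.single a 1)) rfl
  have hcont : ∀ ψ : EuclideanSpace ℝ (Fin d) → ℝ, ContDiff ℝ 1 ψ →
      Integrable (fun x => gradDot d v ψ x) volume := by
    intro ψ hψ
    refine integrable_finsetSum _ fun a _ => ?_
    exact ((hvd a).mul ((hψ.continuous_fderiv one_ne_zero).clm_apply
      continuous_const)).integrable_of_hasCompactSupport (hvdc a).mul_right
  have hcont2 : ∀ ψ : EuclideanSpace ℝ (Fin d) → ℝ, ContDiff ℝ 1 ψ →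
      Integrable (fun x => g x * ψ x) volume := fun ψ hψ =>
    (hg.mul hψ.continuous).integrable_of_hasCompactSupport hgc.mul_right
  have hiB : Integrable (fun x => (∑ a : Fin d, |fderiv ℝ v x (EuclideanSpace.single a 1)|) + |g x|)
      volume := by
    refine Integrable.add (integrable_finsetSum _ fun a _ => ?_) ?_
    · exact ((hvd a).integrable_of_hasCompactSupport (hvdc a)).abs
    · exact (hg.integrable_of_hasCompactSupport hgc).abs
  set B := ∫ x, ((∑ a : Fin d, |fderiv ℝ v x (EuclideanSpace.single a 1)|) + |g x|) with hB
  have hB0 : 0 ≤ B := integral_nonneg fun x => by positivity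
  have key : ∀ ε : ℝ, 0 < ε → |(∫ x, gradDot d v φ x) + ∫ x, g x * φ x| ≤ ε * B := by
    intro ε hε
    obtain ⟨ψ, hψ, hψc, hψs, h1, h2⟩ := aux_mollify hφ hc hW hs hε
    have hψ1 : ContDiff ℝ 1 ψ := by exact_mod_cast hψ 1
    have e := h ψ hψ hψc hψs
    have : (∫ x, gradDot d v φ x) + ∫ x, g x * φ x
        = ∫ x, ((gradDot d v φ x + g x * φ x) - (gradDot d v ψ x + g x * ψ x)) := by
      rw [integral_sub (f := fun x => gradDot d v φ x + g x * φ x)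
        (g := fun x => gradDot d v ψ x + g x * ψ x)
        ((hcont φ hφ).add (hcont2 φ hφ)) ((hcont ψ hψ1).add (hcont2 ψ hψ1)),
        integral_add (hcont φ hφ) (hcont2 φ hφ), integral_add (hcont ψ hψ1) (hcont2 ψ hψ1), e,
        sub_zero]
    rw [this, hB, ← integral_const_mul, ← Real.norm_eq_abs]
    refine norm_integral_le_of_norm_le (hiB.const_mul ε) (Filter.Eventually.of_forall fun x => ?_)
    have e3 : (gradDot d v φ x + g x * φ x) - (gradDot d v ψ x + g x * ψ x)
        = (∑ a : Fin d, -(fderiv ℝ v x (EuclideanSpace.single a 1) *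
          ((fderiv ℝ ψ x - fderiv ℝ φ x) (EuclideanSpace.single a 1)))) - g x * (ψ x - φ x) := by
      have : (∑ a : Fin d, -(fderiv ℝ v x (EuclideanSpace.single a 1) *
          ((fderiv ℝ ψ x - fderiv ℝ φ x) (EuclideanSpace.single a 1))))
          = gradDot d v φ x - gradDot d v ψ x := by
        unfold gradDot
        rw [← Finset.sum_sub_distrib]
        refine Finset.sum_congr rfl fun a _ => ?_
        simp only [sub_apply]
        ring
      rw [this]; ring
    rw [e3, Real.norm_eq_abs, mul_add, Finset.mul_sum]
    refine (abs_sub _ _).trans (add_le_add ((Finset.abs_sum_le_sum_abs _ _).trans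
      (Finset.sum_le_sum fun a _ => ?_)) ?_)
    · rw [abs_neg, abs_mul, mul_comm]
      gcongr
      have := (fderiv ℝ ψ x - fderiv ℝ φ x).le_opNorm (EuclideanSpace.single a (1:ℝ))
      simp only [PiLp.norm_single, norm_one, mul_one] at this
      exact this.trans (h2 x)
    · rw [abs_mul, mul_comm]
      gcongr
      exact h1 x
  by_contra hne
  have hpos := abs_pos.2 hne
  have := key (|(∫ x, gradDot d v φ x) + ∫ x, g x * φ x| / (2 * (B + 1))) (by positivity)
  rw [div_mul_eq_mul_div, le_div_iff₀ (by positivity)] at this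
  nlinarith

lemma aux_hasDerivAt_F {s : ℝ} (hs : 0 < s) (t : ℝ) :
    HasDerivAt (fun t : ℝ => |t| ^ s * t) ((s + 1) * |t| ^ s) t := by
  have hne : ∀ y : ℝ, y ≠ 0 → HasDerivAt (fun t : ℝ => |t| ^ s * t) ((s + 1) * |y| ^ s) y := by
    intro y hy
    have h1 := ((hasDerivAt_abs hy).rpow_const (p := s) (Or.inl (abs_ne_zero.2 hy))).mul
      (hasDerivAt_id y)
    convert! h1 using 1
    have h2 : |y| ^ s = |y| ^ (s - 1) * |y| := by
      rw [← Real.rpow_add_one (abs_ne_zero.2 hy)]; congr 1; ring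
    have h3 : ((SignType.sign y : SignType) : ℝ) * y = |y| := sign_mul_self y
    simp only [id]
    rw [h2]
    calc _ = s * |y| ^ (s - 1) * |y| + |y| ^ (s - 1) * |y| := by ring
      _ = _ := by rw [← h3]; ring
  have hc : Continuous fun t : ℝ => |t| ^ s := continuous_abs.rpow_const fun _ => Or.inr hs.le
  rcases eq_or_ne t 0 with rfl | ht
  · exact hasDerivAt_of_hasDerivAt_of_ne (g := fun y => (s + 1) * |y| ^ s) hne
      (hc.mul continuous_id).continuousAt (continuous_const.mul hc).continuousAt
  · exact hne t ht

lemma aux_contDiff_F {s : ℝ} (hs : 0 < s) : ContDiff ℝ 1 (fun t : ℝ => |t| ^ s * t) := by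
  refine contDiff_one_iff_deriv.2 ⟨fun t => (aux_hasDerivAt_F hs t).differentiableAt, ?_⟩
  have : deriv (fun t : ℝ => |t| ^ s * t) = fun t => (s + 1) * |t| ^ s :=
    funext fun t => (aux_hasDerivAt_F hs t).deriv
  rw [this]
  exact continuous_const.mul (continuous_abs.rpow_const fun _ => Or.inr hs.le)

lemma aux_opNorm {d : ℕ} (L : EuclideanSpace ℝ (Fin d) →L[ℝ] ℝ) :
    ‖L‖ ^ 2 ≤ ∑ a : Fin d, L (EuclideanSpace.single a 1) ^ 2 := by
  have h0 : 0 ≤ ∑ a : Fin d, L (EuclideanSpace.single a 1) ^ 2 :=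
    Finset.sum_nonneg fun a _ => sq_nonneg _
  have : ‖L‖ ≤ √(∑ a : Fin d, L (EuclideanSpace.single a 1) ^ 2) := by
    refine L.opNorm_le_bound (Real.sqrt_nonneg _) fun x => ?_
    have hx : L x = ∑ a : Fin d, L (EuclideanSpace.single a 1) * x a := by
      conv_lhs => rw [← (EuclideanSpace.basisFun (Fin d) ℝ).sum_repr x]
      rw [map_sum]
      refine Finset.sum_congr rfl fun a _ => ?_
      simp [mul_comm]
    rw [hx, EuclideanSpace.norm_eq, ← Real.sqrt_mul h0, Real.norm_eq_abs]
    refine Real.abs_le_sqrt ?_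
    simpa using Finset.sum_mul_sq_le_sq_mul_sq Finset.univ
      (fun a => L (EuclideanSpace.single a 1)) (fun a => x a)
  calc ‖L‖ ^ 2 ≤ (√(∑ a : Fin d, L (EuclideanSpace.single a 1) ^ 2)) ^ 2 := by gcongr
    _ = _ := Real.sq_sqrt h0

lemma aux_sobolev (d : ℕ) (hd : 3 ≤ d) : ∃ S : ℝ, 0 < S ∧
    ∀ w : EuclideanSpace ℝ (Fin d) → ℝ, ContDiff ℝ 1 w → HasCompactSupport w →
      (∫ x, |w x| ^ (2 * (d : ℝ) / ((d : ℝ) - 2))) ^ (2 / (2 * (d : ℝ) / ((d : ℝ) - 2)))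
        ≤ S * ∫ x, gradNormSq d w x := by
  have hD : (3 : ℝ) ≤ d := by exact_mod_cast hd
  have hr0 : 0 < 2 * (d : ℝ) / ((d : ℝ) - 2) := div_pos (by linarith) (by linarith)
  set r : ℝ := 2 * (d : ℝ) / ((d : ℝ) - 2) with hr
  set c : ℝ := (eLpNormLESNormFDerivOfEqInnerConst
    (volume : Measure (EuclideanSpace ℝ (Fin d))) ((2 : NNReal) : ℝ) : ℝ) with hc
  refine ⟨c ^ 2 + 1, by positivity, fun w hw hwc => ?_⟩
  have hsob := eLpNorm_le_eLpNorm_fderiv_of_eq_inner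
    (volume : Measure (EuclideanSpace ℝ (Fin d))) hw hwc (p := 2) (p' := r.toNNReal)
    (by norm_num) (by simp; omega) (by
      rw [Real.coe_toNNReal _ hr0.le, hr]
      have h1 : (d : ℝ) - 2 ≠ 0 := by linarith
      have h2 : (d : ℝ) ≠ 0 := by linarith
      simp only [finrank_euclideanSpace, Fintype.card_fin]
      push_cast
      field_simp)
  have hdc : Continuous (fderiv ℝ w) := hw.continuous_fderiv one_ne_zero
  have hm1 : MemLp w (r.toNNReal : ENNReal) volume := hw.continuous.memLp_of_hasCompactSupport hwc
  have hm2 : MemLp (fderiv ℝ w) ((2 : NNReal) : ENNReal) volume :=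
    hdc.memLp_of_hasCompactSupport (hwc.fderiv ℝ)
  rw [hm1.eLpNorm_eq_integral_rpow_norm (by simpa using hr0) (by simp),
    hm2.eLpNorm_eq_integral_rpow_norm (by simp) (by simp)] at hsob
  have hJ0 : 0 ≤ ∫ x, ‖fderiv ℝ w x‖ ^ (2:ℝ) := integral_nonneg fun x => by positivity
  have hI0 : 0 ≤ ∫ x, |w x| ^ r := integral_nonneg fun x => by positivity
  have h3 : (∫ x, |w x| ^ r) ^ r⁻¹ ≤ c * (∫ x, ‖fderiv ℝ w x‖ ^ (2:ℝ)) ^ (2:ℝ)⁻¹ := by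
    have e1 : ((eLpNormLESNormFDerivOfEqInnerConst
        (volume : Measure (EuclideanSpace ℝ (Fin d))) ((2 : NNReal) : ℝ) : NNReal) : ENNReal)
        = ENNReal.ofReal c := by rw [hc, ENNReal.ofReal_coe_nnreal]
    rw [e1, ← ENNReal.ofReal_mul (by positivity), ENNReal.ofReal_le_ofReal_iff (by positivity)] at hsob
    simpa [Real.coe_toNNReal _ hr0.le] using hsob
  have h4 : ∫ x, ‖fderiv ℝ w x‖ ^ (2:ℝ) ≤ ∫ x, gradNormSq d w x := by
    refine integral_mono ?_ ?_ fun x => ?_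
    · refine Continuous.integrable_of_hasCompactSupport (hdc.norm.rpow_const fun _ => Or.inr (by norm_num)) ?_
      exact (hwc.fderiv ℝ).comp_left (g := fun L => ‖L‖ ^ (2:ℝ)) (by simp)
    · refine integrable_finsetSum _ fun a _ => ?_
      refine Continuous.integrable_of_hasCompactSupport ((hdc.clm_apply continuous_const).pow 2) ?_
      exact (hwc.fderiv ℝ).comp_left (g := fun L : EuclideanSpace ℝ (Fin d) →L[ℝ] ℝ =>
        L (EuclideanSpace.single a 1) ^ 2) (by simp)
    · have := aux_opNorm (fderiv ℝ w x)
      rw [← Real.rpow_two] at this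
      exact this
  have h5 : (∫ x, |w x| ^ r) ^ (2 / r) = ((∫ x, |w x| ^ r) ^ r⁻¹) ^ 2 := by
    rw [← Real.rpow_natCast, ← Real.rpow_mul hI0]; congr 1; push_cast; field_simp
  have h6 : ((∫ x, ‖fderiv ℝ w x‖ ^ (2:ℝ)) ^ (2:ℝ)⁻¹) ^ 2 = ∫ x, ‖fderiv ℝ w x‖ ^ (2:ℝ) := by
    rw [← Real.rpow_natCast, ← Real.rpow_mul hJ0]; norm_num
  rw [h5]
  calc ((∫ x, |w x| ^ r) ^ r⁻¹) ^ 2 ≤ (c * (∫ x, ‖fderiv ℝ w x‖ ^ (2:ℝ)) ^ (2:ℝ)⁻¹) ^ 2 := by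
        gcongr
    _ = c ^ 2 * ∫ x, ‖fderiv ℝ w x‖ ^ (2:ℝ) := by rw [mul_pow, h6]
    _ ≤ (c ^ 2 + 1) * ∫ x, gradNormSq d w x := by gcongr; linarith

lemma aux_holder {d : ℕ} {s : ℝ} (hs : 0 < s) {w v : EuclideanSpace ℝ (Fin d) → ℝ}
    (hw : Continuous w) (hwc : HasCompactSupport w) (hv : Continuous v)
    (hvc : HasCompactSupport v) :
    ∫ x, w x ^ 2 * |v x| ^ s
      ≤ (∫ x, |w x| ^ (s + 2)) ^ (2 / (s + 2)) * (∫ x, |v x| ^ (s + 2)) ^ (s / (s + 2)) := by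
  have hpq : Real.HolderConjugate ((s + 2) / 2) ((s + 2) / s) := by
    rw [Real.holderConjugate_iff]
    constructor
    · linarith
    · field_simp; ring
  have m1 : MemLp (fun x => w x ^ 2) (ENNReal.ofReal ((s + 2) / 2)) volume := by
    refine (hw.pow 2).memLp_of_hasCompactSupport ?_
    refine hwc.mono fun x hx h0 => hx ?_
    show w x ^ 2 = 0
    rw [show w x = 0 from h0]; norm_num
  have m2 : MemLp (fun x => |v x| ^ s) (ENNReal.ofReal ((s + 2) / s)) volume := by
    refine (hv.abs.rpow_const fun _ => Or.inr hs.le).memLp_of_hasCompactSupport ?_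
    refine hvc.mono fun x hx h0 => hx ?_
    simp only [h0, abs_zero]; exact Real.zero_rpow hs.ne'
  have n1 : 0 ≤ᵐ[volume] (fun x => w x ^ 2) := Filter.Eventually.of_forall fun x => sq_nonneg _
  have n2 : 0 ≤ᵐ[volume] (fun x => |v x| ^ s) :=
    Filter.Eventually.of_forall fun x => Real.rpow_nonneg (abs_nonneg _) _
  have h := integral_mul_le_Lp_mul_Lq_of_nonneg hpq n1 n2 m1 m2
  have e1 : ∀ x, (w x ^ 2) ^ ((s + 2) / 2) = |w x| ^ (s + 2) := fun x => by
    rw [← sq_abs, ← Real.rpow_natCast, ← Real.rpow_mul (abs_nonneg _)]; congr 1; push_cast; ring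
  have e2 : ∀ x, (|v x| ^ s) ^ ((s + 2) / s) = |v x| ^ (s + 2) := fun x => by
    rw [← Real.rpow_mul (abs_nonneg _)]; congr 1; field_simp
  simp only [e1, e2, one_div_div] at h
  exact h

lemma aux_point {K s η a b p v G G' F P Q : ℝ} (hs : 0 < s)
    (hK : K = 2 * (1 + s / 2) ^ 2 / (s + 1 / 2)) (hP : P = p ^ 2) (hF : F = p ^ 2 * v)
    (hQ : Q = p ^ 2 * v ^ 2)
    (hG : G ^ 2 = p ^ 2 * v ^ 2) (hG' : G' ^ 2 = (1 + s / 2) ^ 2 * p ^ 2) :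
    (η * (G' * a) + G * b) ^ 2
      ≤ K * (a * (η ^ 2 * ((s + 1) * P * a) + F * (2 * η * b))) + (2 + 2 * K) * (Q * b ^ 2) := by
  have hK0 : 0 ≤ K := by rw [hK]; positivity
  have hKs : K * (s + 1 / 2) = 2 * (1 + s / 2) ^ 2 := by rw [hK]; field_simp
  have h1 : (η * (G' * a) + G * b) ^ 2
      ≤ 2 * (1 + s / 2) ^ 2 * (η ^ 2 * p ^ 2 * a ^ 2) + 2 * (p ^ 2 * v ^ 2 * b ^ 2) := by
    have e1 : 2 * (1 + s / 2) ^ 2 * (η ^ 2 * p ^ 2 * a ^ 2) + 2 * (p ^ 2 * v ^ 2 * b ^ 2)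
        = 2 * η ^ 2 * G' ^ 2 * a ^ 2 + 2 * G ^ 2 * b ^ 2 := by rw [hG, hG']; ring
    rw [e1]
    nlinarith [sq_nonneg (η * (G' * a) - G * b)]
  have h2 : 0 ≤ K * (p ^ 2 / 2 * (η * a + 2 * v * b) ^ 2) := by positivity
  rw [← hKs] at h1
  subst hP hF hQ
  nlinarith

lemma aux_core {d : ℕ} {s S M K κ : ℝ} (hs : 0 < s) (hS : 0 < S)
    (hK : K = 2 * (1 + s / 2) ^ 2 / (s + 1 / 2)) (hκ : |κ| ≤ 1)
    {v η : EuclideanSpace ℝ (Fin d) → ℝ} (hv : ContDiff ℝ 1 v) (hvc : HasCompactSupport v)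
    (hη : ContDiff ℝ 1 η) (hηM : ∀ x, gradNormSq d η x ≤ M)
    (hsob : ∀ w : EuclideanSpace ℝ (Fin d) → ℝ, ContDiff ℝ 1 w → HasCompactSupport w →
      (∫ x, |w x| ^ (s + 2)) ^ (2 / (s + 2)) ≤ S * ∫ x, gradNormSq d w x)
    (hweak : (∫ x, gradDot d v (fun x => η x ^ 2 * (|v x| ^ s * v x)) x)
      + ∫ x, (κ * (|v x| ^ s * v x)) * (η x ^ 2 * (|v x| ^ s * v x)) = 0)
    (hsmall : S * K * (∫ x, |v x| ^ (s + 2)) ^ (s / (s + 2)) ≤ 1 / 2) :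
    (∫ x, |η x * |v x| ^ (1 + s / 2)| ^ (s + 2)) ^ (2 / (s + 2))
      ≤ 2 * S * ((2 + 2 * K) * M) * ∫ x, |v x| ^ (s + 2) := by
  have hK0 : 0 ≤ K := by rw [hK]; positivity
  have hcF : ContDiff ℝ 1 (fun x => |v x| ^ s * v x) := (aux_contDiff_F hs).comp hv
  have hβ : 1 < 1 + s / 2 := by linarith
  have hcG : ContDiff ℝ 1 (fun x => |v x| ^ (1 + s / 2)) := hv.norm_rpow hβ
  set φ : EuclideanSpace ℝ (Fin d) → ℝ := fun x => η x ^ 2 * (|v x| ^ s * v x) with hφ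
  set w : EuclideanSpace ℝ (Fin d) → ℝ := fun x => η x * |v x| ^ (1 + s / 2) with hw
  have hcφ : ContDiff ℝ 1 φ := (hη.pow 2).mul hcF
  have hcw : ContDiff ℝ 1 w := hη.mul hcG
  have hwc : HasCompactSupport w := by
    refine hvc.mono fun x hx h0 => hx ?_
    show η x * |v x| ^ (1 + s / 2) = 0
    rw [show v x = 0 from h0, abs_zero, Real.zero_rpow (by linarith), mul_zero]
  have hφc : HasCompactSupport φ := by
    refine hvc.mono fun x hx h0 => hx ?_
    show η x ^ 2 * (|v x| ^ s * v x) = 0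
    rw [show v x = 0 from h0, mul_zero, mul_zero]
  have hqc : HasCompactSupport fun x => |v x| ^ (s + 2) := by
    refine hvc.mono fun x hx h0 => hx ?_
    show |v x| ^ (s + 2) = 0
    rw [show v x = 0 from h0, abs_zero, Real.zero_rpow (by linarith)]
  have hqcont : Continuous fun x => |v x| ^ (s + 2) :=
    hv.continuous.abs.rpow_const fun _ => Or.inr (by linarith)
  have hcomp : ∀ (f : EuclideanSpace ℝ (Fin d) → ℝ), ContDiff ℝ 1 f → ∀ a : Fin d,
      Continuous fun x => fderiv ℝ f x (EuclideanSpace.single a 1) :=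
    fun f hf a => (hf.continuous_fderiv one_ne_zero).clm_apply continuous_const
  have hcs : ∀ (f : EuclideanSpace ℝ (Fin d) → ℝ), HasCompactSupport f → ∀ a : Fin d,
      HasCompactSupport fun x => fderiv ℝ f x (EuclideanSpace.single a 1) :=
    fun f hf a => (hf.fderiv ℝ).comp_left (g := fun L : EuclideanSpace ℝ (Fin d) →L[ℝ] ℝ =>
      L (EuclideanSpace.single a 1)) rfl
  have hgη : Continuous fun x => gradNormSq d η x :=
    continuous_finsetSum _ fun a _ => (hcomp η hη a).pow 2
  have i1 : Integrable (fun x => gradNormSq d w x) volume := by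
    refine integrable_finsetSum _ fun a _ => ?_
    simp only [sq]
    exact ((hcomp w hcw a).mul (hcomp w hcw a)).integrable_of_hasCompactSupport
      (hcs w hwc a).mul_right
  have i2 : Integrable (fun x => gradDot d v φ x) volume := by
    refine integrable_finsetSum _ fun a _ => ?_
    exact ((hcomp v hv a).mul (hcomp φ hcφ a)).integrable_of_hasCompactSupport
      (hcs v hvc a).mul_right
  have i3 : Integrable (fun x => |v x| ^ (s + 2) * gradNormSq d η x) volume :=
    (hqcont.mul hgη).integrable_of_hasCompactSupport hqc.mul_right
  have i4 : Integrable (fun x => |v x| ^ (s + 2)) volume :=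
    hqcont.integrable_of_hasCompactSupport hqc
  -- pointwise inequality
  have hpt : ∀ x, gradNormSq d w x
      ≤ K * gradDot d v φ x + (2 + 2 * K) * (|v x| ^ (s + 2) * gradNormSq d η x) := by
    intro x
    have hvd := (hv.differentiable one_ne_zero x).hasFDerivAt
    have hηd := (hη.differentiable one_ne_zero x).hasFDerivAt
    have dF := (aux_hasDerivAt_F hs (v x)).comp_hasFDerivAt x hvd
    have dG := (hasDerivAt_abs_rpow (v x) hβ).comp_hasFDerivAt x hvd
    have dφ : HasFDerivAt φ _ x := (hηd.pow 2).mul dF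
    have dw : HasFDerivAt w _ x := hηd.mul dG
    unfold gradNormSq gradDot
    rw [Finset.mul_sum, Finset.mul_sum, Finset.mul_sum, ← Finset.sum_add_distrib]
    refine Finset.sum_le_sum fun a _ => ?_
    rw [dw.fderiv, dφ.fderiv]
    have hp0 : 0 ≤ |v x| := abs_nonneg _
    have hP : |v x| ^ s = (|v x| ^ (s / 2)) ^ 2 := by
      rw [← Real.rpow_natCast, ← Real.rpow_mul hp0]; congr 1; push_cast; ring
    have hQ : |v x| ^ (s + 2) = (|v x| ^ (s / 2)) ^ 2 * v x ^ 2 := by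
      rw [Real.rpow_add_of_nonneg hp0 hs.le (by norm_num), hP, Real.rpow_two, sq_abs]
    have hG : (|v x| ^ (1 + s / 2)) ^ 2 = (|v x| ^ (s / 2)) ^ 2 * v x ^ 2 := by
      rw [Real.rpow_add_of_nonneg hp0 (by norm_num) (by linarith), Real.rpow_one, mul_pow, sq_abs,
        mul_comm]
    have hG' : ((1 + s / 2) * |v x| ^ (1 + s / 2 - 2) * v x) ^ 2
        = (1 + s / 2) ^ 2 * (|v x| ^ (s / 2)) ^ 2 := by
      rcases eq_or_ne (v x) 0 with h0 | h0
      · rw [h0, abs_zero, Real.zero_rpow (by linarith : s / 2 ≠ 0)]; ring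
      · have : |v x| ^ (s / 2) = |v x| ^ (1 + s / 2 - 2) * |v x| := by
          rw [← Real.rpow_add_one (abs_ne_zero.2 h0)]; congr 1; ring
        rw [this, mul_pow _ |v x|, sq_abs]; ring
    have := aux_point (K := K) (s := s) (η := η x)
      (a := fderiv ℝ v x (EuclideanSpace.single a 1))
      (b := fderiv ℝ η x (EuclideanSpace.single a 1)) (p := |v x| ^ (s / 2)) (v := v x)
      (G := |v x| ^ (1 + s / 2)) (G' := (1 + s / 2) * |v x| ^ (1 + s / 2 - 2) * v x)
      (F := |v x| ^ s * v x) (P := |v x| ^ s) (Q := |v x| ^ (s + 2)) hs hK hP (by rw [hP]) hQ hG hG'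
    convert! this using 2
    simp
  have hint : ∫ x, gradNormSq d w x
      ≤ K * (∫ x, gradDot d v φ x) + (2 + 2 * K) * (M * ∫ x, |v x| ^ (s + 2)) := by
    calc ∫ x, gradNormSq d w x
        ≤ ∫ x, (K * gradDot d v φ x + (2 + 2 * K) * (|v x| ^ (s + 2) * gradNormSq d η x)) :=
          integral_mono i1 ((i2.const_mul K).add (i3.const_mul _)) hpt
      _ = K * (∫ x, gradDot d v φ x)
          + (2 + 2 * K) * ∫ x, |v x| ^ (s + 2) * gradNormSq d η x := by
          rw [integral_add (i2.const_mul K) (i3.const_mul _), integral_const_mul,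
            integral_const_mul]
      _ ≤ _ := by
          gcongr
          rw [← integral_const_mul]
          refine integral_mono i3 (i4.const_mul M) fun x => ?_
          show |v x| ^ (s + 2) * gradNormSq d η x ≤ M * |v x| ^ (s + 2)
          rw [mul_comm]
          gcongr
          exact hηM x
  have hGD : ∫ x, gradDot d v φ x ≤ ∫ x, w x ^ 2 * |v x| ^ s := by
    have e1 : ∫ x, (κ * (|v x| ^ s * v x)) * (η x ^ 2 * (|v x| ^ s * v x))
        = κ * ∫ x, w x ^ 2 * |v x| ^ s := by
      rw [← integral_const_mul]
      congr 1
      ext x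
      have hp0 : 0 ≤ |v x| := abs_nonneg _
      have hG : (|v x| ^ (1 + s / 2)) ^ 2 = |v x| ^ s * v x ^ 2 := by
        rw [← Real.rpow_natCast, ← Real.rpow_mul hp0,
          show (1 + s / 2) * ((2 : ℕ) : ℝ) = s + 2 by push_cast; ring,
          Real.rpow_add_of_nonneg hp0 hs.le (by norm_num), Real.rpow_two, sq_abs]
      rw [hw]
      simp only [mul_pow]
      rw [hG]
      ring
    rw [e1] at hweak
    have hn : 0 ≤ ∫ x, w x ^ 2 * |v x| ^ s := integral_nonneg fun x => by positivity
    have := (abs_le.1 hκ).1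
    nlinarith
  have hho := aux_holder hs hcw.continuous hwc hv.continuous hvc
  have hX := hsob w hcw hwc
  set X := (∫ x, |w x| ^ (s + 2)) ^ (2 / (s + 2)) with hXd
  set A := ∫ x, |v x| ^ (s + 2) with hA
  have hX0 : 0 ≤ X := Real.rpow_nonneg (integral_nonneg fun x => by positivity) _
  show X ≤ _
  have h1 : X ≤ S * (K * (X * A ^ (s / (s + 2))) + (2 + 2 * K) * (M * A)) := by
    refine hX.trans ?_
    gcongr
    refine hint.trans ?_
    gcongr
    exact hGD.trans hho
  have h2 : S * K * A ^ (s / (s + 2)) * X ≤ 1 / 2 * X := by gcongr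
  nlinarith

lemma aux_bump (d : ℕ) {a b c e : ℝ} (ha : 0 < a) (hab : a < b) (hc : 0 < c) (hce : c < e) :
    ∃ η : EuclideanSpace ℝ (Fin d) → ℝ, ContDiff ℝ 1 η ∧ HasCompactSupport η ∧
      (∀ x, 0 ≤ η x) ∧ (∀ x, η x ≤ 1) ∧ (∀ x, b ≤ ‖x‖ → ‖x‖ ≤ c → η x = 1) ∧
      tsupport η ⊆ {x | a ≤ ‖x‖ ∧ ‖x‖ ≤ e} := by
  let f : ContDiffBump (0 : EuclideanSpace ℝ (Fin d)) := ⟨c, e, hc, hce⟩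
  let g : ContDiffBump (0 : EuclideanSpace ℝ (Fin d)) := ⟨a, b, ha, hab⟩
  refine ⟨fun x => f x * (1 - g x), f.contDiff.mul (contDiff_const.sub g.contDiff),
    f.hasCompactSupport.mul_right, fun x => mul_nonneg f.nonneg (sub_nonneg.2 g.le_one),
    fun x => mul_le_one₀ f.le_one (sub_nonneg.2 g.le_one) (by linarith [g.nonneg' x]), ?_, ?_⟩
  · intro x h1 h2
    have e1 : f x = 1 := f.one_of_mem_closedBall (by simpa using h2)
    have e2 : g x = 0 := g.zero_of_le_dist (by simpa using h1)
    simp [e1, e2]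
  · refine closure_minimal ?_ ((isClosed_le continuous_const continuous_norm).inter
      (isClosed_le continuous_norm continuous_const))
    intro x hx
    constructor
    · show a ≤ ‖x‖
      by_contra hlt
      push Not at hlt
      apply hx
      have : g x = 1 := g.one_of_mem_closedBall (by simpa using hlt.le)
      simp [this]
    · show ‖x‖ ≤ e
      by_contra hlt
      push Not at hlt
      apply hx
      have : f x = 0 := f.zero_of_le_dist (by simpa using hlt.le)
      simp [this]

lemma aux_main (d : ℕ) (s S : ℝ) (hs : 0 < s) (hS : 0 < S)
    (hsob : ∀ w : EuclideanSpace ℝ (Fin d) → ℝ, ContDiff ℝ 1 w → HasCompactSupport w →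
      (∫ x, |w x| ^ (s + 2)) ^ (2 / (s + 2)) ≤ S * ∫ x, gradNormSq d w x) :
    ∃ ε₀ : ℝ, 0 < ε₀ ∧ ∃ C : ℝ, 0 < C ∧
    ∀ κ : ℝ, |κ| ≤ 1 →
    ∀ u : EuclideanSpace ℝ (Fin d) → ℝ,
      ContDiffOn ℝ 1 u {x : EuclideanSpace ℝ (Fin d) | 1/2 ≤ ‖x‖} →
      IntegrableOn (fun x => |u x| ^ (s + 2))
        {x : EuclideanSpace ℝ (Fin d) | 1/2 ≤ ‖x‖} volume →
      (∀ φ : EuclideanSpace ℝ (Fin d) → ℝ,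
        (∀ n : ℕ, ContDiff ℝ n φ) → HasCompactSupport φ →
        tsupport φ ⊆ {x : EuclideanSpace ℝ (Fin d) | 1/2 < ‖x‖} →
        (∫ x in {x : EuclideanSpace ℝ (Fin d) | 1/2 ≤ ‖x‖}, gradDot d u φ x)
          + κ * ∫ x in {x : EuclideanSpace ℝ (Fin d) | 1/2 ≤ ‖x‖},
              |u x| ^ s * u x * φ x = 0) →
      (∫ x in {x : EuclideanSpace ℝ (Fin d) | 1/2 ≤ ‖x‖}, |u x| ^ (s + 2)) ^ (1 / (s + 2)) ≤ ε₀ →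
      (∫ x in {x : EuclideanSpace ℝ (Fin d) | 3/4 < ‖x‖ ∧ ‖x‖ < 3/2},
          |u x| ^ ((1 + s / 2) * (s + 2))) ^ (2 / (s + 2) * (1 / (s + 2)))
        ≤ C * (∫ x in {x : EuclideanSpace ℝ (Fin d) | 1/2 ≤ ‖x‖},
            |u x| ^ (s + 2)) ^ (1 / (s + 2)) := by
  obtain ⟨η, hη, hηc, hη0, hη1, hηe, hηs⟩ := aux_bump d (a := 5/8) (b := 3/4) (c := 3/2) (e := 2)
    (by norm_num) (by norm_num) (by norm_num) (by norm_num)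
  obtain ⟨χ, hχ, hχc, hχ0, hχ1, hχe, hχs⟩ := aux_bump d (a := 17/32) (b := 9/16) (c := 3) (e := 4)
    (by norm_num) (by norm_num) (by norm_num) (by norm_num)
  obtain ⟨M, hM0, hM⟩ : ∃ M : ℝ, 0 < M ∧ ∀ x, gradNormSq d η x ≤ M := by
    have hc : Continuous fun x => gradNormSq d η x := continuous_finsetSum _ fun a _ =>
      ((hη.continuous_fderiv one_ne_zero).clm_apply continuous_const).pow 2
    have hcs : HasCompactSupport fun x => gradNormSq d η x := by
      refine (hηc.fderiv ℝ).mono fun x hx h0 => hx ?_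
      show gradNormSq d η x = 0
      simp [gradNormSq, show fderiv ℝ η x = 0 from h0]
    obtain ⟨B, hB⟩ := hc.bounded_above_of_compact_support hcs
    exact ⟨|B| + 1, by positivity, fun x => by
      linarith [le_abs_self (gradNormSq d η x), hB x, le_abs_self B,
        Real.norm_eq_abs (gradNormSq d η x)]⟩
  obtain ⟨K, hK⟩ : ∃ K : ℝ, K = 2 * (1 + s / 2) ^ 2 / (s + 1 / 2) := ⟨_, rfl⟩
  have hK0 : 0 < K := by rw [hK]; positivity
  set C' : ℝ := 2 * S * ((2 + 2 * K) * M) with hC'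
  have hC'0 : 0 < C' := by positivity
  refine ⟨(1 / (2 * (S * K))) ^ (1 / s), by positivity, C' ^ (1 / (s + 2)), by positivity, ?_⟩
  intro κ hκ u hu hui hweak hε
  set Ω : Set (EuclideanSpace ℝ (Fin d)) := {x | 1/2 ≤ ‖x‖} with hΩ
  have hΩm : MeasurableSet Ω := measurableSet_le measurable_const measurable_norm
  set A₀ := ∫ x in Ω, |u x| ^ (s + 2) with hA₀
  have hA₀0 : 0 ≤ A₀ := integral_nonneg fun x => by positivity
  set v : EuclideanSpace ℝ (Fin d) → ℝ := fun x => χ x * u x with hvdef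
  have hopen : IsOpen {x : EuclideanSpace ℝ (Fin d) | 1/2 < ‖x‖} :=
    isOpen_lt continuous_const continuous_norm
  have hv : ContDiff ℝ 1 v := by
    rw [contDiff_iff_contDiffAt]
    intro x
    by_cases hx : 1/2 < ‖x‖
    · refine hχ.contDiffAt.mul (hu.contDiffAt ?_)
      filter_upwards [hopen.mem_nhds hx] with y hy
      exact le_of_lt hy
    · have hx' : x ∉ tsupport χ := fun h => hx (by have := (hχs h).1; linarith)
      have : v =ᶠ[nhds x] fun _ => 0 := by
        filter_upwards [notMem_tsupport_iff_eventuallyEq.1 hx'] with y hy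
        simp [hvdef, hy]
      exact contDiffAt_const.congr_of_eventuallyEq this
  have hvc : HasCompactSupport v := hχc.mul_right
  set W : Set (EuclideanSpace ℝ (Fin d)) := {x | 9/16 < ‖x‖ ∧ ‖x‖ < 3} with hWd
  have hW : IsOpen W := (isOpen_lt continuous_const continuous_norm).inter
    (isOpen_lt continuous_norm continuous_const)
  have hvu : ∀ x ∈ W, v x = u x := fun x hx => by
    simp [hvdef, hχe x (le_of_lt hx.1) (le_of_lt hx.2)]
  have hWΩ : ∀ x ∈ W, x ∈ Ω := fun x hx => by
    have := hx.1
    show 1/2 ≤ ‖x‖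
    linarith
  have hvu' : ∀ x ∈ W, fderiv ℝ v x = fderiv ℝ u x := fun x hx => by
    apply Filter.EventuallyEq.fderiv_eq
    filter_upwards [hW.mem_nhds hx] with y hy using hvu y hy
  have hFc : Continuous fun x => κ * (|v x| ^ s * v x) :=
    continuous_const.mul ((aux_contDiff_F hs).comp hv).continuous
  have hFcs : HasCompactSupport fun x => κ * (|v x| ^ s * v x) := by
    refine hvc.mono fun x hx h0 => hx ?_
    show κ * (|v x| ^ s * v x) = 0
    rw [show v x = 0 from h0, mul_zero, mul_zero]
  have hweak2 : ∀ φ : EuclideanSpace ℝ (Fin d) → ℝ, (∀ n : ℕ, ContDiff ℝ n φ) →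
      HasCompactSupport φ → tsupport φ ⊆ W →
      (∫ x, gradDot d v φ x) + ∫ x, (κ * (|v x| ^ s * v x)) * φ x = 0 := by
    intro φ h1 h2 h3
    have h := hweak φ h1 h2 fun x hx => by
      have := (h3 hx).1
      show 1/2 < ‖x‖
      linarith
    have z1 : ∀ x, x ∉ tsupport φ → fderiv ℝ φ x = 0 := fun x hx => fderiv_of_notMem_tsupport ℝ hx
    have z2 : ∀ x, x ∉ tsupport φ → φ x = 0 := fun x hx => image_eq_zero_of_notMem_tsupport hx
    rw [setIntegral_eq_integral_of_forall_compl_eq_zero, setIntegral_eq_integral_of_forall_compl_eq_zero,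
      ← integral_const_mul] at h
    · rw [← h]
      congr 1
      · congr 1
        ext x
        by_cases hx : x ∈ tsupport φ
        · simp only [gradDot, hvu' x (h3 hx)]
        · simp [gradDot, z1 x hx]
      · congr 1
        ext x
        by_cases hx : x ∈ tsupport φ
        · rw [hvu x (h3 hx)]; ring
        · simp [z2 x hx]
    · intro x hx
      rw [z2 x fun hx' => hx (hWΩ x (h3 hx')), mul_zero]
    · intro x hx
      simp [gradDot, z1 x fun hx' => hx (hWΩ x (h3 hx'))]
  have hφts : tsupport (fun x => η x ^ 2 * (|v x| ^ s * v x)) ⊆ tsupport η := by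
    refine closure_mono fun x hx h0 => hx ?_
    show η x ^ 2 * (|v x| ^ s * v x) = 0
    rw [show η x = 0 from h0]; ring
  have hid := aux_weak_ext hv hvc hFc hFcs hW hweak2
    (φ := fun x => η x ^ 2 * (|v x| ^ s * v x)) ((hη.pow 2).mul ((aux_contDiff_F hs).comp hv))
    (IsCompact.of_isClosed_subset hηc (isClosed_tsupport _) hφts)
    (hφts.trans fun x hx => ⟨by linarith [(hηs hx).1], by linarith [(hηs hx).2]⟩)
  have hs2 : 0 < s + 2 := by linarith
  have hAle : ∫ x, |v x| ^ (s + 2) ≤ A₀ := by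
    have hz : ∀ x, x ∉ Ω → |v x| ^ (s + 2) = 0 := by
      intro x hx
      have : χ x = 0 := image_eq_zero_of_notMem_tsupport fun h => hx (by
        have := (hχs h).1
        show 1/2 ≤ ‖x‖
        linarith)
      simp [hvdef, this, Real.zero_rpow hs2.ne']
    rw [← setIntegral_eq_integral_of_forall_compl_eq_zero hz]
    refine setIntegral_mono_on ?_ hui hΩm fun x _ => ?_
    · refine Integrable.integrableOn ?_
      refine Continuous.integrable_of_hasCompactSupport
        (hv.continuous.abs.rpow_const fun _ => Or.inr hs2.le) ?_
      refine hvc.mono fun x hx h0 => hx ?_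
      show |v x| ^ (s + 2) = 0
      rw [show v x = 0 from h0, abs_zero, Real.zero_rpow hs2.ne']
    · refine Real.rpow_le_rpow (abs_nonneg _) ?_ hs2.le
      rw [hvdef]
      simp only [abs_mul, abs_of_nonneg (hχ0 x)]
      exact mul_le_of_le_one_left (abs_nonneg _) (hχ1 x)
  have hA0 : 0 ≤ ∫ x, |v x| ^ (s + 2) := integral_nonneg fun x => by positivity
  have hsmall : S * K * (∫ x, |v x| ^ (s + 2)) ^ (s / (s + 2)) ≤ 1 / 2 := by
    have h1 : (∫ x, |v x| ^ (s + 2)) ^ (s / (s + 2)) ≤ 1 / (2 * (S * K)) := by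
      calc (∫ x, |v x| ^ (s + 2)) ^ (s / (s + 2)) ≤ A₀ ^ (s / (s + 2)) := by gcongr
        _ = (A₀ ^ (1 / (s + 2))) ^ s := by rw [← Real.rpow_mul hA₀0]; congr 1; ring
        _ ≤ ((1 / (2 * (S * K))) ^ (1 / s)) ^ s := by gcongr
        _ = 1 / (2 * (S * K)) := by
          rw [← Real.rpow_mul (by positivity), one_div_mul_cancel hs.ne', Real.rpow_one]
    calc S * K * (∫ x, |v x| ^ (s + 2)) ^ (s / (s + 2)) ≤ S * K * (1 / (2 * (S * K))) := by gcongr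
      _ = 1 / 2 := by field_simp
  have hcore := aux_core hs hS hK hκ hv hvc hη hM hsob hid hsmall
  have hwcont : Continuous fun x => |η x * |v x| ^ (1 + s / 2)| ^ (s + 2) :=
    ((hη.continuous.mul (hv.continuous.abs.rpow_const fun _ => Or.inr (by linarith))).abs).rpow_const
      fun _ => Or.inr hs2.le
  have hwcs : HasCompactSupport fun x => |η x * |v x| ^ (1 + s / 2)| ^ (s + 2) := by
    refine hηc.mono fun x hx h0 => hx ?_
    show |η x * |v x| ^ (1 + s / 2)| ^ (s + 2) = 0
    rw [show η x = 0 from h0, zero_mul, abs_zero, Real.zero_rpow hs2.ne']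
  have hann : ∫ x in {x : EuclideanSpace ℝ (Fin d) | 3/4 < ‖x‖ ∧ ‖x‖ < 3/2},
      |u x| ^ ((1 + s / 2) * (s + 2)) ≤ ∫ x, |η x * |v x| ^ (1 + s / 2)| ^ (s + 2) := by
    have hm : MeasurableSet {x : EuclideanSpace ℝ (Fin d) | 3/4 < ‖x‖ ∧ ‖x‖ < 3/2} :=
      (measurableSet_lt measurable_const measurable_norm).inter
        (measurableSet_lt measurable_norm measurable_const)
    calc _ = ∫ x in {x : EuclideanSpace ℝ (Fin d) | 3/4 < ‖x‖ ∧ ‖x‖ < 3/2},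
          |η x * |v x| ^ (1 + s / 2)| ^ (s + 2) := by
          refine setIntegral_congr_fun hm fun x hx => ?_
          have h1 := hx.1
          have h2 := hx.2
          show |u x| ^ ((1 + s / 2) * (s + 2)) = |η x * |v x| ^ (1 + s / 2)| ^ (s + 2)
          rw [hηe x h1.le h2.le, hvu x ⟨by linarith, by linarith⟩, one_mul,
            abs_of_nonneg (Real.rpow_nonneg (abs_nonneg _) _), ← Real.rpow_mul (abs_nonneg _)]
      _ ≤ _ := setIntegral_le_integral (hwcont.integrable_of_hasCompactSupport hwcs)
          (Filter.Eventually.of_forall fun x => Real.rpow_nonneg (abs_nonneg _) _)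
  have hann0 : 0 ≤ ∫ x in {x : EuclideanSpace ℝ (Fin d) | 3/4 < ‖x‖ ∧ ‖x‖ < 3/2},
      |u x| ^ ((1 + s / 2) * (s + 2)) :=
    integral_nonneg fun x => Real.rpow_nonneg (abs_nonneg _) _
  rw [Real.rpow_mul hann0, ← Real.mul_rpow hC'0.le hA₀0]
  refine Real.rpow_le_rpow (Real.rpow_nonneg hann0 _) ?_ (by positivity)
  calc _ ≤ (∫ x, |η x * |v x| ^ (1 + s / 2)| ^ (s + 2)) ^ (2 / (s + 2)) := by gcongr
    _ ≤ C' * ∫ x, |v x| ^ (s + 2) := hcore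
    _ ≤ C' * A₀ := by gcongr

theorem stmt14 (d : ℕ) (hd : 3 ≤ d) :
    ∃ ε₀ : ℝ, 0 < ε₀ ∧ ∃ C : ℝ, 0 < C ∧
    ∀ κ : ℝ, |κ| ≤ 1 →
    ∀ u : EuclideanSpace ℝ (Fin d) → ℝ,
      ContDiffOn ℝ 1 u {x : EuclideanSpace ℝ (Fin d) | 1/2 ≤ ‖x‖} →
      IntegrableOn (fun x => gradNormSq d u x)
        {x : EuclideanSpace ℝ (Fin d) | 1/2 ≤ ‖x‖} volume →
      IntegrableOn (fun x => |u x| ^ (2 * (d : ℝ) / ((d : ℝ) - 2)))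
        {x : EuclideanSpace ℝ (Fin d) | 1/2 ≤ ‖x‖} volume →
      (∀ φ : EuclideanSpace ℝ (Fin d) → ℝ,
        (∀ n : ℕ, ContDiff ℝ n φ) → HasCompactSupport φ →
        tsupport φ ⊆ {x : EuclideanSpace ℝ (Fin d) | 1/2 < ‖x‖} →
        (∫ x in {x : EuclideanSpace ℝ (Fin d) | 1/2 ≤ ‖x‖}, gradDot d u φ x)
          + κ * ∫ x in {x : EuclideanSpace ℝ (Fin d) | 1/2 ≤ ‖x‖},
              |u x| ^ (((d : ℝ) + 2) / ((d : ℝ) - 2) - 1) * u x * φ x = 0) →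
      (∫ x in {x : EuclideanSpace ℝ (Fin d) | 1/2 ≤ ‖x‖},
          |u x| ^ (2 * (d : ℝ) / ((d : ℝ) - 2))) ^ (((d : ℝ) - 2) / (2 * (d : ℝ))) ≤ ε₀ →
      (∫ x in {x : EuclideanSpace ℝ (Fin d) | 3/4 < ‖x‖ ∧ ‖x‖ < 3/2},
          |u x| ^ (2 * (d : ℝ) ^ 2 / ((d : ℝ) - 2) ^ 2)) ^
            (((d : ℝ) - 2) ^ 2 / (2 * (d : ℝ) ^ 2))
        ≤ C * (∫ x in {x : EuclideanSpace ℝ (Fin d) | 1/2 ≤ ‖x‖},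
            |u x| ^ (2 * (d : ℝ) / ((d : ℝ) - 2))) ^ (((d : ℝ) - 2) / (2 * (d : ℝ))) := by
  have hD : (3 : ℝ) ≤ d := by exact_mod_cast hd
  have h1 : (d : ℝ) - 2 ≠ 0 := by linarith
  have h2 : (d : ℝ) ≠ 0 := by linarith
  have hs : 0 < 4 / ((d : ℝ) - 2) := div_pos (by norm_num) (by linarith)
  obtain ⟨S, hS, hsob⟩ := aux_sobolev d hd
  obtain ⟨s, hsd⟩ : ∃ s : ℝ, s = 4 / ((d : ℝ) - 2) := ⟨_, rfl⟩
  have e1 : 2 * (d : ℝ) / ((d : ℝ) - 2) = s + 2 := by rw [hsd]; field_simp; ring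
  have e2 : ((d : ℝ) + 2) / ((d : ℝ) - 2) - 1 = s := by rw [hsd]; field_simp; ring
  have e3 : ((d : ℝ) - 2) / (2 * (d : ℝ)) = 1 / (s + 2) := by rw [← e1]; field_simp
  have e5 : (d : ℝ) / ((d : ℝ) - 2) = 1 + s / 2 := by rw [hsd]; field_simp; ring
  have e4 : 2 * (d : ℝ) ^ 2 / ((d : ℝ) - 2) ^ 2 = (1 + s / 2) * (s + 2) := by
    rw [← e1, ← e5]; field_simp
  have e6 : ((d : ℝ) - 2) ^ 2 / (2 * (d : ℝ) ^ 2) = 2 / (s + 2) * (1 / (s + 2)) := by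
    rw [← e1]; field_simp; try ring
  rw [← hsd] at hs
  simp only [e1] at hsob
  obtain ⟨ε₀, hε₀, C, hC, H⟩ := aux_main d s S hs hS hsob
  refine ⟨ε₀, hε₀, C, hC, fun κ hκ u hu _ hui hw hε => ?_⟩
  simp only [e1, e2, e3, e4, e6] at hui hw hε ⊢
  exact H κ hκ u hu hui hw hε
end
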